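/- arXiv:2602.06010 — 3 statements merged into one kernel-verified Lean document; each statement's English description precedes it below -/
import Mathlib

section
/- (Local Calderón–Zygmund decomposition) Let κ ∈ (2,3] and R > 0 with D_{3κR} < ∞. Let E ⊆ X be μ-measurable with μ(E) > 0 and diam(E) < R, let f ∈ L^1(μ;B) be concentrated in E, and let α > D_{3κR}^4 ‖f‖_{L^1(μ;B)} / μ(E). Then there exist a countable set N ⊆ E, a function r : N → (0,R], and μ-measurable functions g, h_x : X → B (x ∈ N) such that: (1) f = g + Σ_{x∈N} h_x; (2) g is concentrated in B(E,R/2) and ‖g‖_{L^∞(μ;B)} ≤ D_{3κR}^2 α; (3) ‖g‖_{L^1(μ;B)} ≤ 3‖f‖_{L^1(μ;B)}; (4) each h_x is concentrated in B(x,r(x)) ⊆ B(E,R/2) and Σ_{x∈N} μ(B(x,r(x))) ≤ D_{3κR}^6 ‖f‖_{L^1(μ;B)} / α; (5) ∫_X h_x dμ = 0 for every x ∈ N; (6) ‖h_x‖_{L^∞(μ;B)} ≤ 2‖f‖_{L^∞(μ;B)} for each x ∈ N, and Σ_{x∈N} ‖h_x‖_{L^1(μ;B)} ≤ 2‖f‖_{L^1(μ;B)};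 (7) Σ_{x∈N} χ_{B(x,r(x))} ≤ D_{3κR}^5. -/
open MeasureTheory Metric Set ENNReal NNReal

section Doubling

variable {X : Type*} [MetricSpace X] [MeasurableSpace X] {μ : Measure X} {D : ℝ≥0} {L : ℝ}

theorem measure_ball_two_pow_mul_le
    (hD : ∀ (x : X) (r : ℝ), 0 < r → r ≤ L → μ (ball x (2 * r)) ≤ (D : ℝ≥0∞) * μ (ball x r))
    (x : X) (n : ℕ) {r : ℝ} (hr : 0 < r) (hrL : 2 ^ n * r ≤ 2 * L) :
    μ (ball x (2 ^ n * r)) ≤ (D : ℝ≥0∞) ^ n * μ (ball x r) := by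
  induction n with
  | zero => simp
  | succ n ih =>
    have hp : 0 < 2 ^ n * r := by positivity
    have h1 : 2 ^ n * r ≤ L := by rw [pow_succ] at hrL; linarith
    calc μ (ball x (2 ^ (n + 1) * r)) = μ (ball x (2 * (2 ^ n * r))) := by
          congr 2; ring
      _ ≤ (D : ℝ≥0∞) * μ (ball x (2 ^ n * r)) := hD x _ hp h1
      _ ≤ (D : ℝ≥0∞) * ((D : ℝ≥0∞) ^ n * μ (ball x r)) := by
          gcongr
          exact ih (by linarith)
      _ = _ := by ring

theorem measure_ball_lt_top [IsLocallyFiniteMeasure μ]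
    (hD : ∀ (x : X) (r : ℝ), 0 < r → r ≤ L → μ (ball x (2 * r)) ≤ (D : ℝ≥0∞) * μ (ball x r))
    (hL : 0 < L) (x : X) {r : ℝ} (hr : r ≤ 2 * L) : μ (ball x r) < ⊤ := by
  obtain ⟨ε, hε, hfin⟩ : ∃ ε > 0, μ (ball x ε) < ⊤ := by
    obtain ⟨s, hs, hsfin⟩ := μ.finiteAt_nhds x
    obtain ⟨ε, hε, hεs⟩ := Metric.mem_nhds_iff.1 hs
    exact ⟨ε, hε, (measure_mono hεs).trans_lt hsfin⟩
  obtain ⟨n, hn⟩ := pow_unbounded_of_one_lt (2 * L / ε) (one_lt_two : (1 : ℝ) < 2)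
  have hn' : 2 * L / 2 ^ n ≤ ε := by
    rw [div_lt_iff₀ hε] at hn
    rw [div_le_iff₀ (by positivity)]
    linarith
  have hmul : (2 : ℝ) ^ n * (2 * L / 2 ^ n) = 2 * L := by field_simp
  calc μ (ball x r) ≤ μ (ball x (2 ^ n * (2 * L / 2 ^ n))) := by
        rw [hmul]; exact measure_mono (ball_subset_ball hr)
    _ ≤ (D : ℝ≥0∞) ^ n * μ (ball x (2 * L / 2 ^ n)) :=
        measure_ball_two_pow_mul_le hD x n (by positivity) hmul.le
    _ ≤ (D : ℝ≥0∞) ^ n * μ (ball x ε) := by gcongr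
    _ < ⊤ := ENNReal.mul_lt_top (by simp) hfin

theorem isSeparable_ball_of_measure_lt_top [BorelSpace X]
    (hpos : ∀ (x : X) (r : ℝ), 0 < r → 0 < μ (ball x r)) {x : X} {r ρ : ℝ} (hrρ : r < ρ)
    (hfin : μ (ball x ρ) < ⊤) : TopologicalSpace.IsSeparable (ball x r) := by
  suffices h : ∃ t ⊆ ball x r, t.Countable ∧ ball x r ⊆ closure t from
    let ⟨t, _, htc, ht⟩ := h; ⟨t, htc, ht⟩
  refine EMetric.subset_countable_closure_of_almost_dense_set _ fun ε hε => ?_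
  obtain ⟨δ, hδ, hδε⟩ : ∃ δ : ℝ, 0 < δ ∧ ENNReal.ofReal δ < ε := by
    obtain ⟨δ, hδ, hδε⟩ := ENNReal.lt_iff_exists_nnreal_btwn.1 hε
    exact ⟨δ, by exact_mod_cast hδ, by simpa using hδε⟩
  set η := min (δ / 4) (ρ - r) with hη
  have hη0 : 0 < η := lt_min (by linarith) (by linarith)
  obtain ⟨u, hu, hdisj, hcov⟩ := Vitali.exists_disjoint_subfamily_covering_enlargement_ball
    (ball x r) id (fun _ => η) η (fun _ _ => le_rfl) 4 (by norm_num)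
  refine ⟨u, ?_, fun y hy => ?_⟩
  · have := Measure.countable_meas_pos_of_disjoint_of_meas_iUnion_ne_top μ
      (As := fun y : u => ball (y : X) η) (fun _ => measurableSet_ball)
      (fun a b hab => hdisj a.2 b.2 (Subtype.coe_injective.ne hab))
      ((measure_mono (iUnion_subset fun y => ball_subset_ball' (by
        have := mem_ball.1 (hu y.2)
        have := min_le_right (δ / 4) (ρ - r)
        linarith))).trans_lt hfin).ne
    rw [← Set.countable_coe_iff, ← Set.countable_univ_iff]
    convert this
    exact (Set.eq_univ_of_forall fun y => hpos _ _ hη0).symm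
  · obtain ⟨b, hb, hsub⟩ := hcov y hy
    refine mem_biUnion hb ?_
    have h1 := mem_ball.1 (hsub (mem_ball_self hη0))
    rw [mem_closedEBall, edist_dist]
    refine le_trans (ENNReal.ofReal_le_ofReal ?_) hδε.le
    have := min_le_left (δ / 4) (ρ - r)
    simp only [id] at h1
    linarith

theorem secondCountableTopology_of_isSeparable_ball {X : Type*} [MetricSpace X]
    [ConnectedSpace X] {r : ℝ} (hr : 0 < r)
    (hsep : ∀ x : X, TopologicalSpace.IsSeparable (ball x r)) : SecondCountableTopology X := by
  choose t htc ht using hsep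
  obtain ⟨x₀⟩ := (inferInstance : Nonempty X)
  let C : ℕ → Set X := fun n => Nat.rec {x₀} (fun _ A => ⋃ a ∈ A, t a) n
  have hC : ∀ n, (C n).Countable := by
    intro n
    induction n with
    | zero => exact countable_singleton x₀
    | succ n ih => exact ih.biUnion fun a _ => htc a
  have hopen : IsOpen (closure (⋃ n, C n)) := by
    rw [Metric.isOpen_iff]
    intro y hy
    obtain ⟨c, hc, hyc⟩ := Metric.mem_closure_iff.1 hy (r / 2) (by positivity)
    obtain ⟨n, hn⟩ := mem_iUnion.1 hc
    refine ⟨r / 2, by positivity, ?_⟩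
    calc ball y (r / 2) ⊆ ball c r := ball_subset_ball' (by linarith)
      _ ⊆ closure (t c) := ht c
      _ ⊆ closure (⋃ n, C n) := closure_mono
          ((subset_biUnion_of_mem (u := t) hn).trans (subset_iUnion C (n + 1)))
  have huniv : closure (⋃ n, C n) = univ :=
    IsClopen.eq_univ ⟨isClosed_closure, hopen⟩
      ⟨x₀, subset_closure (mem_iUnion.2 ⟨0, mem_singleton x₀⟩)⟩
  have : TopologicalSpace.SeparableSpace X :=
    ⟨⟨⋃ n, C n, countable_iUnion hC, dense_iff_closure_eq.2 huniv⟩⟩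
  exact UniformSpace.secondCountable_of_separable X

theorem isUnifLocDoublingMeasure_of_ball
    (hD : ∀ (x : X) (r : ℝ), 0 < r → r ≤ L → μ (ball x (2 * r)) ≤ (D : ℝ≥0∞) * μ (ball x r))
    (hL : 0 < L) : IsUnifLocDoublingMeasure μ := by
  refine ⟨⟨D ^ 2, ?_⟩⟩
  filter_upwards [Ioc_mem_nhdsGT (show (0 : ℝ) < L / 2 by positivity)] with ε hε x
  calc μ (closedBall x (2 * ε)) ≤ μ (ball x (2 ^ 2 * ε)) :=
        measure_mono (closedBall_subset_ball (by linarith [hε.1]))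
    _ ≤ (D : ℝ≥0∞) ^ 2 * μ (ball x ε) :=
        measure_ball_two_pow_mul_le hD x 2 hε.1 (by linarith [hε.2])
    _ ≤ ((D ^ 2 : ℝ≥0) : ℝ≥0∞) * μ (closedBall x ε) := by
        push_cast
        gcongr
        exact ball_subset_closedBall

end Doubling

theorem enorm_setAverage_le {X B : Type*} [MeasurableSpace X] {μ : Measure X}
    [NormedAddCommGroup B] [NormedSpace ℝ B] {f : X → B} {Q : Set X} {C : ℝ≥0∞}
    (h0 : μ Q ≠ 0) (hT : μ Q ≠ ⊤) (h : ∫⁻ z in Q, ‖f z‖ₑ ∂μ ≤ C * μ Q) :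
    ‖⨍ z in Q, f z ∂μ‖ₑ ≤ C := by
  rw [setAverage_eq, enorm_smul,
    enorm_inv (by simp [measureReal_def, ENNReal.toReal_eq_zero_iff, h0, hT]),
    measureReal_def, Real.enorm_of_nonneg ENNReal.toReal_nonneg, ENNReal.ofReal_toReal hT,
    mul_comm, ← div_eq_mul_inv]
  exact ENNReal.div_le_of_le_mul ((enorm_integral_le_lintegral_enorm f).trans h)

section MaximalSet

variable {X B : Type*} [MetricSpace X] [MeasurableSpace X] [NormedAddCommGroup B]

/-- The superlevel set of a local uncentred maximal function: the union of the balls of radius at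
most `ρ` on which the average of `‖f‖` exceeds `a / D`. -/
def maximalSuperlevelSet (μ : Measure X) (f : X → B) (D : ℝ≥0) (ρ : ℝ) (a : ℝ≥0∞) : Set X :=
  ⋃ p ∈ {p : X × ℝ | 0 < p.2 ∧ p.2 ≤ ρ ∧
    a * μ (ball p.1 p.2) < (D : ℝ≥0∞) * ∫⁻ z in ball p.1 p.2, ‖f z‖ₑ ∂μ}, ball p.1 p.2

variable {μ : Measure X} {f : X → B} {D : ℝ≥0} {ρ L : ℝ} {a : ℝ≥0∞}

theorem isOpen_maximalSuperlevelSet : IsOpen (maximalSuperlevelSet μ f D ρ a) :=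
  isOpen_biUnion fun _ _ => isOpen_ball

theorem mul_lintegral_ball_le_of_notMem_maximalSuperlevelSet {w y : X} {r : ℝ}
    (hw : w ∉ maximalSuperlevelSet μ f D ρ a) (hwy : w ∈ ball y r) (hr : r ≤ ρ) :
    (D : ℝ≥0∞) * ∫⁻ z in ball y r, ‖f z‖ₑ ∂μ ≤ a * μ (ball y r) := by
  by_contra! h
  exact hw (mem_biUnion (x := (y, r)) ⟨pos_of_mem_ball hwy, hr, h⟩ hwy)

theorem mul_measure_maximalSuperlevelSet_le [BorelSpace X] [SecondCountableTopology X]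
    (hD : ∀ (x : X) (r : ℝ), 0 < r → r ≤ L → μ (ball x (2 * r)) ≤ (D : ℝ≥0∞) * μ (ball x r))
    (hρ : 2 * ρ ≤ L) :
    a * μ (maximalSuperlevelSet μ f D ρ a) ≤ (D : ℝ≥0∞) ^ 3 * ∫⁻ z, ‖f z‖ₑ ∂μ := by
  set t := {p : X × ℝ | 0 < p.2 ∧ p.2 ≤ ρ ∧
    a * μ (ball p.1 p.2) < (D : ℝ≥0∞) * ∫⁻ z in ball p.1 p.2, ‖f z‖ₑ ∂μ} with ht
  obtain ⟨u, hut, hdisj, hcov⟩ := Vitali.exists_disjoint_subfamily_covering_enlargement_ball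
    t Prod.fst Prod.snd ρ (fun p hp => hp.2.1) 4 (by norm_num)
  have huc : u.Countable := hdisj.countable_of_isOpen (fun _ _ => isOpen_ball)
    fun p hp => nonempty_ball.2 (hut hp).1
  have hsub : maximalSuperlevelSet μ f D ρ a ⊆ ⋃ p ∈ u, ball p.1 (4 * p.2) := by
    refine iUnion₂_subset fun p hp => ?_
    obtain ⟨q, hq, hpq⟩ := hcov p hp
    exact hpq.trans (subset_biUnion_of_mem (u := fun q : X × ℝ => ball q.1 (4 * q.2)) hq)
  calc a * μ (maximalSuperlevelSet μ f D ρ a)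
      ≤ a * ∑' p : u, μ (ball p.1.1 (4 * p.1.2)) := by
        gcongr
        exact (measure_mono hsub).trans (measure_biUnion_le _ huc _)
    _ = ∑' p : u, a * μ (ball p.1.1 (4 * p.1.2)) := ENNReal.tsum_mul_left.symm
    _ ≤ ∑' p : u, (D : ℝ≥0∞) ^ 3 * ∫⁻ z in ball p.1.1 p.1.2, ‖f z‖ₑ ∂μ := by
        refine ENNReal.tsum_le_tsum fun p => ?_
        obtain ⟨h0, h1, h2⟩ := hut p.2
        have h4 : μ (ball p.1.1 (4 * p.1.2)) ≤ (D : ℝ≥0∞) ^ 2 * μ (ball p.1.1 p.1.2) := by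
          have := measure_ball_two_pow_mul_le hD p.1.1 2 h0 (by linarith)
          norm_num at this
          exact this
        calc a * μ (ball p.1.1 (4 * p.1.2))
            ≤ a * ((D : ℝ≥0∞) ^ 2 * μ (ball p.1.1 p.1.2)) := by gcongr
          _ = (D : ℝ≥0∞) ^ 2 * (a * μ (ball p.1.1 p.1.2)) := by ring
          _ ≤ (D : ℝ≥0∞) ^ 2 * ((D : ℝ≥0∞) * ∫⁻ z in ball p.1.1 p.1.2, ‖f z‖ₑ ∂μ) := by
              gcongr
          _ = _ := by ring
    _ = (D : ℝ≥0∞) ^ 3 * ∫⁻ z in ⋃ p ∈ u, ball p.1 p.2, ‖f z‖ₑ ∂μ := by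
        rw [ENNReal.tsum_mul_left, lintegral_biUnion huc (fun _ _ => measurableSet_ball) hdisj]
    _ ≤ (D : ℝ≥0∞) ^ 3 * ∫⁻ z, ‖f z‖ₑ ∂μ := by
        gcongr
        exact Measure.restrict_le_self

theorem ae_enorm_le_of_notMem_maximalSuperlevelSet [BorelSpace X] [SecondCountableTopology X]
    [IsLocallyFiniteMeasure μ] [NormedSpace ℝ B] [CompleteSpace B]
    (hpos : ∀ (x : X) (r : ℝ), 0 < r → 0 < μ (ball x r)) (hD0 : D ≠ 0)
    (hD : ∀ (x : X) (r : ℝ), 0 < r → r ≤ L → μ (ball x (2 * r)) ≤ (D : ℝ≥0∞) * μ (ball x r))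
    (hL : 0 < L) (hρ : 0 < ρ) (hf : Integrable f μ) :
    ∀ᵐ z ∂μ, z ∉ maximalSuperlevelSet μ f D ρ a → ‖f z‖ₑ ≤ a := by
  have := isUnifLocDoublingMeasure_of_ball hD hL
  filter_upwards [IsUnifLocDoublingMeasure.ae_tendsto_average μ hf.locallyIntegrable 1]
    with z hz hzΩ
  have hlim := hz (l := nhdsWithin (0 : ℝ) (Ioi 0)) (fun _ => z) id Filter.tendsto_id (by
    filter_upwards [self_mem_nhdsWithin] with r hr
    exact mem_closedBall_self (by simpa using (mem_Ioi.1 hr).le))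
  refine le_of_tendsto hlim.enorm ?_
  filter_upwards [Ioc_mem_nhdsGT (lt_min (half_pos hρ) hL)] with r hr
  have hr1 : 2 * r ≤ ρ := by linarith [hr.2.trans (min_le_left _ _)]
  have hr2 : r ≤ L := hr.2.trans (min_le_right _ _)
  have hsub : closedBall z r ⊆ ball z (2 * r) := closedBall_subset_ball (by linarith [hr.1])
  refine enorm_setAverage_le
    ((hpos z r hr.1).trans_le (measure_mono ball_subset_closedBall)).ne'
    ((measure_mono hsub).trans_lt (measure_ball_lt_top hD hL z (by linarith))).ne ?_
  rw [← ENNReal.mul_le_mul_iff_right (a := (D : ℝ≥0∞)) (by simpa using hD0) (by simp)]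
  calc (D : ℝ≥0∞) * ∫⁻ y in closedBall z r, ‖f y‖ₑ ∂μ
      ≤ (D : ℝ≥0∞) * ∫⁻ y in ball z (2 * r), ‖f y‖ₑ ∂μ := by
        gcongr
    _ ≤ a * μ (ball z (2 * r)) := mul_lintegral_ball_le_of_notMem_maximalSuperlevelSet hzΩ
        (mem_ball_self (by linarith [hr.1])) hr1
    _ ≤ a * ((D : ℝ≥0∞) * μ (ball z r)) := by gcongr; exact hD z r hr.1 hr2
    _ ≤ a * ((D : ℝ≥0∞) * μ (closedBall z r)) := by gcongr; exact ball_subset_closedBall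
    _ = (D : ℝ≥0∞) * (a * μ (closedBall z r)) := by ring

end MaximalSet

section Whitney

theorem exists_pairwiseDisjoint_between {ι X : Type*} [MeasurableSpace X] {N : Set ι}
    (hN : N.Countable) {S T : ι → Set X} (hS : ∀ x ∈ N, MeasurableSet (S x))
    (hT : ∀ x ∈ N, MeasurableSet (T x)) (hST : ∀ x ∈ N, S x ⊆ T x) (hdisj : N.PairwiseDisjoint S) :
    ∃ Q : ι → Set X, (∀ x ∈ N, MeasurableSet (Q x)) ∧ (∀ x ∈ N, S x ⊆ Q x) ∧
      (∀ x ∈ N, Q x ⊆ T x) ∧ N.PairwiseDisjoint Q ∧ ⋃ x ∈ N, T x ⊆ ⋃ x ∈ N, Q x := by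
  obtain ⟨e, he⟩ := countable_iff_exists_injOn.1 hN
  let A : ι → Set X := fun x => T x \ ⋃ y ∈ {y ∈ N | y ≠ x}, S y
  have hA : ∀ x ∈ N, MeasurableSet (A x) := fun x hx =>
    (hT x hx).diff (.biUnion (hN.mono (sep_subset _ _)) fun y hy => hS y hy.1)
  have hSA : ∀ x ∈ N, ∀ y ∈ N, x ≠ y → Disjoint (S x) (A y) := fun x hx y hy hxy =>
    disjoint_left.2 fun z hz hz' => hz'.2 (mem_biUnion (x := x) ⟨hx, hxy⟩ hz)
  refine ⟨fun x => A x \ ⋃ y ∈ {y ∈ N | e y < e x}, A y, fun x hx => ?_, fun x hx z hz => ?_,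
    fun x hx => sdiff_subset.trans sdiff_subset, fun x hx y hy hxy => ?_,
    iUnion₂_subset fun x hx z hz => ?_⟩
  · exact (hA x hx).diff (.biUnion (hN.mono (sep_subset _ _)) fun y hy => hA y hy.1)
  · refine ⟨⟨hST x hx hz, fun h => ?_⟩, fun h => ?_⟩
    · obtain ⟨y, hy, hzy⟩ := mem_iUnion₂.1 h
      exact disjoint_left.1 (hdisj hy.1 hx hy.2) hzy hz
    · obtain ⟨y, hy, hzy⟩ := mem_iUnion₂.1 h
      exact disjoint_left.1 (hSA x hx y hy.1 fun h => (h ▸ hy.2).false) hz hzy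
  · refine disjoint_left.2 fun z hzx hzy => ?_
    rcases lt_or_gt_of_ne (he.ne hx hy hxy) with h | h
    · exact hzy.2 (mem_biUnion (x := x) ⟨hx, h⟩ hzx.1)
    · exact hzx.2 (mem_biUnion (x := y) ⟨hy, h⟩ hzy.1)
  · have hne : {n | ∃ y ∈ N, e y = n ∧ z ∈ A y}.Nonempty := by
      by_cases h : z ∈ ⋃ y ∈ {y ∈ N | y ≠ x}, S y
      · obtain ⟨y, hy, hzy⟩ := mem_iUnion₂.1 h
        refine ⟨e y, y, hy.1, rfl, hST y hy.1 hzy, fun h' => ?_⟩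
        obtain ⟨w, hw, hzw⟩ := mem_iUnion₂.1 h'
        exact disjoint_left.1 (hdisj hw.1 hy.1 hw.2) hzw hzy
      · exact ⟨e x, x, hx, rfl, hz, h⟩
    obtain ⟨y, hy, hey, hzy⟩ := Nat.sInf_mem hne
    refine mem_biUnion hy ⟨hzy, fun h => ?_⟩
    obtain ⟨w, hw, hzw⟩ := mem_iUnion₂.1 h
    exact Nat.notMem_of_lt_sInf (hw.2.trans_eq hey) ⟨w, hw.1, rfl, hzw⟩

variable {X : Type*} [MetricSpace X]

theorem exists_whitney_balls [SecondCountableTopology X] {Ω A : Set X} {R : ℝ} (hΩ : IsOpen Ω)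
    (hΩc : Ωᶜ.Nonempty) (hA : A ⊆ Ω) (hR : ∀ x ∈ A, infDist x Ωᶜ ≤ R) :
    ∃ N ⊆ A, N.Countable ∧ N.PairwiseDisjoint (fun x => ball x (infDist x Ωᶜ / 7)) ∧
      A ⊆ ⋃ x ∈ N, ball x (infDist x Ωᶜ / 2) := by
  have hpos : ∀ x ∈ A, 0 < infDist x Ωᶜ := fun x hx =>
    (hΩ.isClosed_compl.notMem_iff_infDist_pos hΩc).1 (not_not.2 (hA hx))
  obtain ⟨N, hNA, hdisj, hcov⟩ := Vitali.exists_disjoint_subfamily_covering_enlargement_ball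
    A id (fun x => infDist x Ωᶜ / 7) (R / 7) (fun x hx => by linarith [hR x hx]) (7 / 2)
    (by norm_num)
  refine ⟨N, hNA, hdisj.countable_of_isOpen (fun _ _ => isOpen_ball) fun x hx =>
    nonempty_ball.2 (by linarith [hpos x (hNA hx)]), hdisj, fun x hx => ?_⟩
  obtain ⟨y, hy, hxy⟩ := hcov x hx
  refine mem_biUnion hy ?_
  have := hxy (mem_ball_self (by linarith [hpos x hx]))
  rwa [show 7 / 2 * (infDist y Ωᶜ / 7) = infDist y Ωᶜ / 2 by ring] at this

theorem card_le_of_mem_whitney_balls [MeasurableSpace X] [BorelSpace X] {μ : Measure X} {D : ℝ≥0}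
    {L : ℝ} [IsLocallyFiniteMeasure μ]
    (hpos : ∀ (x : X) (r : ℝ), 0 < r → 0 < μ (ball x r))
    (hD : ∀ (x : X) (r : ℝ), 0 < r → r ≤ L → μ (ball x (2 * r)) ≤ (D : ℝ≥0∞) * μ (ball x r))
    (hL : 0 < L) {F : Set X} {s : Finset X} {z : X} (hs : s.Nonempty)
    (hs0 : ∀ x ∈ s, 0 < infDist x F) (hsL : ∀ x ∈ s, 16 * infDist x F ≤ 7 * L)
    (hz : ∀ x ∈ s, z ∈ ball x (infDist x F / 2))
    (hdisj : (s : Set X).PairwiseDisjoint (fun x => ball x (infDist x F / 7))) :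
    (s.card : ℝ≥0∞) ≤ (D : ℝ≥0∞) ^ 5 := by
  obtain ⟨y, hy, hmin⟩ := s.exists_min_image (fun x => μ (ball x (infDist x F / 7))) hs
  have hy0 := hs0 y hy
  have hsub : ∀ x ∈ s, ball x (infDist x F / 7) ⊆ ball y (2 ^ 5 * (infDist y F / 7)) := by
    intro x hx
    refine ball_subset_ball' ?_
    have h1 := mem_ball.1 (hz x hx)
    have h2 := mem_ball.1 (hz y hy)
    have h3 : infDist x F ≤ infDist z F + dist x z := infDist_le_infDist_add_dist
    have h4 : infDist z F ≤ infDist y F + dist z y := infDist_le_infDist_add_dist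
    have h5 := dist_triangle x z y
    rw [dist_comm x z] at h3 h5
    linarith
  have hfin : μ (ball y (infDist y F / 7)) ≠ ⊤ :=
    (measure_ball_lt_top hD hL y (by linarith [hsL y hy])).ne
  rw [← ENNReal.mul_le_mul_iff_left (c := μ (ball y (infDist y F / 7)))
    (hpos y _ (by linarith)).ne' hfin]
  calc (s.card : ℝ≥0∞) * μ (ball y (infDist y F / 7))
      = ∑ x ∈ s, μ (ball y (infDist y F / 7)) := by simp
    _ ≤ ∑ x ∈ s, μ (ball x (infDist x F / 7)) := Finset.sum_le_sum hmin
    _ = μ (⋃ x ∈ s, ball x (infDist x F / 7)) :=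
        (measure_biUnion_finset hdisj fun _ _ => measurableSet_ball).symm
    _ ≤ μ (ball y (2 ^ 5 * (infDist y F / 7))) := measure_mono (iUnion₂_subset hsub)
    _ ≤ (D : ℝ≥0∞) ^ 5 * μ (ball y (infDist y F / 7)) :=
        measure_ball_two_pow_mul_le hD y 5 (by linarith) (by linarith [hsL y hy])

end Whitney

section Pieces

variable {ι X B : Type*} [MeasurableSpace X] [NormedAddCommGroup B] [NormedSpace ℝ B]

/-- The restriction of `f` to `Q`, minus its mean over `Q`. -/
noncomputable def fluctuationOn (μ : Measure X) (f : X → B) (Q : Set X) : X → B :=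
  Q.indicator fun z => f z - ⨍ y in Q, f y ∂μ

variable {μ : Measure X} {f : X → B} {Q : Set X}

theorem aestronglyMeasurable_fluctuationOn (hf : AEStronglyMeasurable f μ) (hQ : MeasurableSet Q) :
    AEStronglyMeasurable (fluctuationOn μ f Q) μ :=
  (hf.sub aestronglyMeasurable_const).indicator hQ

theorem integral_fluctuationOn [CompleteSpace B] (hQ : MeasurableSet Q) (hT : μ Q ≠ ⊤) :
    ∫ z, fluctuationOn μ f Q z ∂μ = 0 := by
  have : IsFiniteMeasure (μ.restrict Q) := ⟨by simpa using hT.lt_top⟩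
  rw [fluctuationOn, integral_indicator hQ]
  exact integral_sub_average _ f

theorem lintegral_enorm_fluctuationOn_le (hQ : MeasurableSet Q)
    (h0 : μ Q ≠ 0) (hT : μ Q ≠ ⊤) :
    ∫⁻ z, ‖fluctuationOn μ f Q z‖ₑ ∂μ ≤ 2 * ∫⁻ z in Q, ‖f z‖ₑ ∂μ := by
  have havg : ‖⨍ y in Q, f y ∂μ‖ₑ ≤ (∫⁻ z in Q, ‖f z‖ₑ ∂μ) / μ Q :=
    enorm_setAverage_le h0 hT (ENNReal.div_mul_cancel h0 hT).ge
  simp only [fluctuationOn, enorm_indicator_eq_indicator_enorm]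
  rw [lintegral_indicator hQ]
  calc ∫⁻ z in Q, ‖f z - ⨍ y in Q, f y ∂μ‖ₑ ∂μ
      ≤ ∫⁻ z in Q, (‖f z‖ₑ + ‖⨍ y in Q, f y ∂μ‖ₑ) ∂μ := by
        gcongr
        exact enorm_sub_le
    _ = ∫⁻ z in Q, ‖f z‖ₑ ∂μ + ‖⨍ y in Q, f y ∂μ‖ₑ * μ Q := by
        rw [lintegral_add_right _ measurable_const, setLIntegral_const]
    _ ≤ ∫⁻ z in Q, ‖f z‖ₑ ∂μ + (∫⁻ z in Q, ‖f z‖ₑ ∂μ) / μ Q * μ Q := by gcongr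
    _ = 2 * ∫⁻ z in Q, ‖f z‖ₑ ∂μ := by rw [ENNReal.div_mul_cancel h0 hT, two_mul]

theorem essSup_enorm_fluctuationOn_le (h0 : μ Q ≠ 0) (hT : μ Q ≠ ⊤) :
    essSup (fun z => ‖fluctuationOn μ f Q z‖ₑ) μ ≤ 2 * essSup (fun z => ‖f z‖ₑ) μ := by
  have hae : ∀ᵐ z ∂μ, ‖f z‖ₑ ≤ essSup (fun z => ‖f z‖ₑ) μ := ae_le_essSup
  have havg : ‖⨍ y in Q, f y ∂μ‖ₑ ≤ essSup (fun z => ‖f z‖ₑ) μ := by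
    refine enorm_setAverage_le h0 hT ?_
    rw [← setLIntegral_const]
    exact lintegral_mono_ae (ae_restrict_of_ae hae)
  refine essSup_le_of_ae_le _ ?_
  filter_upwards [hae] with z hz
  by_cases h : z ∈ Q
  · rw [fluctuationOn, indicator_of_mem h, two_mul]
    exact enorm_sub_le.trans (add_le_add hz havg)
  · simp [fluctuationOn, h]

variable {N : Set ι} {S : ι → Set X}

theorem tsum_fluctuationOn_of_mem (hS : N.PairwiseDisjoint S) {x : ι} (hx : x ∈ N) {z : X}
    (hz : z ∈ S x) : ∑' y : N, fluctuationOn μ f (S y) z = f z - ⨍ w in S x, f w ∂μ := by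
  rw [tsum_eq_single ⟨x, hx⟩, fluctuationOn, indicator_of_mem hz]
  intro y hy
  refine indicator_of_notMem (fun h => ?_) _
  exact disjoint_left.1 (hS y.2 hx fun h' => hy (Subtype.ext h')) h hz

theorem tsum_fluctuationOn_of_notMem {z : X} (hz : z ∉ ⋃ x ∈ N, S x) :
    ∑' y : N, fluctuationOn μ f (S y) z = 0 := by
  simp only [mem_iUnion, not_exists] at hz
  simp [fluctuationOn, fun y : N => hz y y.2]

theorem aestronglyMeasurable_sub_tsum_fluctuationOn (hN : N.Countable)
    (hm : ∀ x ∈ N, MeasurableSet (S x)) (hS : N.PairwiseDisjoint S)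
    (hf : AEStronglyMeasurable f μ) :
    AEStronglyMeasurable (fun z => f z - ∑' y : N, fluctuationOn μ f (S y) z) μ := by
  have hU : MeasurableSet (⋃ x ∈ N, S x) := .biUnion hN hm
  have := hN.to_subtype
  set g : X → B := fun z => f z - ∑' y : N, fluctuationOn μ f (S y) z with hg
  rw [← Measure.restrict_univ (μ := μ), ← union_compl_self (⋃ x ∈ N, S x),
    aestronglyMeasurable_union_iff, biUnion_eq_iUnion, aestronglyMeasurable_iUnion_iff]
  refine ⟨fun x => ?_, ?_⟩
  · refine (aestronglyMeasurable_const (b := ⨍ w in S x, f w ∂μ)).congr ?_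
    filter_upwards [ae_restrict_mem (hm x x.2)] with z hz
    rw [hg]
    simp only [tsum_fluctuationOn_of_mem hS x.2 hz, _root_.sub_sub_cancel]
  · refine hf.restrict.congr ?_
    rw [← biUnion_eq_iUnion (t := fun x _ => S x)]
    filter_upwards [ae_restrict_mem hU.compl] with z hz
    rw [hg]
    simp only [tsum_fluctuationOn_of_notMem hz, sub_zero]

theorem tsum_lintegral_enorm_fluctuationOn_le (hN : N.Countable)
    (hm : ∀ x ∈ N, MeasurableSet (S x)) (hS : N.PairwiseDisjoint S)
    (h0 : ∀ x ∈ N, μ (S x) ≠ 0) (hT : ∀ x ∈ N, μ (S x) ≠ ⊤) :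
    ∑' x : N, ∫⁻ z, ‖fluctuationOn μ f (S x) z‖ₑ ∂μ ≤ 2 * ∫⁻ z, ‖f z‖ₑ ∂μ :=
  calc ∑' x : N, ∫⁻ z, ‖fluctuationOn μ f (S x) z‖ₑ ∂μ
      ≤ ∑' x : N, 2 * ∫⁻ z in S x, ‖f z‖ₑ ∂μ := ENNReal.tsum_le_tsum fun x =>
        lintegral_enorm_fluctuationOn_le (hm x x.2) (h0 x x.2) (hT x x.2)
    _ = 2 * ∫⁻ z in ⋃ x ∈ N, S x, ‖f z‖ₑ ∂μ := by
        rw [ENNReal.tsum_mul_left, lintegral_biUnion hN hm hS]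
    _ ≤ 2 * ∫⁻ z, ‖f z‖ₑ ∂μ := by
        gcongr
        exact Measure.restrict_le_self

theorem lintegral_enorm_sub_tsum_fluctuationOn_le (hN : N.Countable)
    (hm : ∀ x ∈ N, MeasurableSet (S x)) (hS : N.PairwiseDisjoint S)
    (hf : AEStronglyMeasurable f μ) (h0 : ∀ x ∈ N, μ (S x) ≠ 0) (hT : ∀ x ∈ N, μ (S x) ≠ ⊤) :
    ∫⁻ z, ‖f z - ∑' y : N, fluctuationOn μ f (S y) z‖ₑ ∂μ ≤ 3 * ∫⁻ z, ‖f z‖ₑ ∂μ := by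
  have := hN.to_subtype
  have hle : ∀ z, ‖∑' y : N, fluctuationOn μ f (S y) z‖ₑ
      ≤ ∑' y : N, ‖fluctuationOn μ f (S y) z‖ₑ := by
    intro z
    by_cases hz : z ∈ ⋃ x ∈ N, S x
    · obtain ⟨x, hx, hzx⟩ := mem_iUnion₂.1 hz
      rw [tsum_fluctuationOn_of_mem hS hx hzx]
      refine le_trans (le_of_eq ?_) (ENNReal.le_tsum ⟨x, hx⟩)
      rw [fluctuationOn, indicator_of_mem hzx]
    · simp [tsum_fluctuationOn_of_notMem hz]
  calc ∫⁻ z, ‖f z - ∑' y : N, fluctuationOn μ f (S y) z‖ₑ ∂μ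
      ≤ ∫⁻ z, (‖f z‖ₑ + ∑' y : N, ‖fluctuationOn μ f (S y) z‖ₑ) ∂μ := by
        gcongr with z
        exact enorm_sub_le.trans (by gcongr; exact hle z)
    _ = ∫⁻ z, ‖f z‖ₑ ∂μ + ∑' y : N, ∫⁻ z, ‖fluctuationOn μ f (S y) z‖ₑ ∂μ := by
        rw [lintegral_add_left' hf.enorm, lintegral_tsum fun y : N =>
          (aestronglyMeasurable_fluctuationOn hf (hm y y.2)).enorm]
    _ ≤ ∫⁻ z, ‖f z‖ₑ ∂μ + 2 * ∫⁻ z, ‖f z‖ₑ ∂μ := by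
        gcongr
        exact tsum_lintegral_enorm_fluctuationOn_le hN hm hS h0 hT
    _ = 3 * ∫⁻ z, ‖f z‖ₑ ∂μ := by ring

end Pieces

/-- local Calderón–Zygmund decomposition. `D` is a finite doubling
constant for radii `≤ 3κR`; `B(E,s)` is the open thickening `Metric.thickening s E`;
"concentrated in `A`" means vanishing a.e. outside `A`. -/
theorem stmt_9 {X : Type*} [MetricSpace X] [MeasurableSpace X] [BorelSpace X]
    [LocallyCompactSpace X] [ConnectedSpace X]
    (μ : Measure X) [μ.InnerRegular] [IsFiniteMeasureOnCompacts μ]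
    (hsupp : ∀ (x : X) (r : ℝ), 0 < r → 0 < μ (ball x r))
    (κ R : ℝ) (hκ1 : 2 < κ) (hκ2 : κ ≤ 3) (hR : 0 < R)
    (D : ℝ≥0) (hD1 : 1 ≤ D)
    (hD : ∀ (x : X), ∀ r ∈ Set.Ioc (0 : ℝ) (3 * κ * R),
      μ (ball x (2 * r)) ≤ (D : ℝ≥0∞) * μ (ball x r))
    {B : Type*} [NormedAddCommGroup B] [NormedSpace ℝ B] [CompleteSpace B]
    (E : Set X) (hE : MeasurableSet E) (hEpos : 0 < μ E)
    (hEd : EMetric.diam E < ENNReal.ofReal R)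
    (f : X → B) (hf : Integrable f μ) (hfE : ∀ᵐ z ∂μ, z ∉ E → f z = 0)
    (a : ℝ≥0∞) (ha : (D : ℝ≥0∞) ^ 4 * (∫⁻ z, (‖f z‖₊ : ℝ≥0∞) ∂μ) / μ E < a) (ha' : a ≠ ⊤) :
    ∃ (N : Set X) (r : X → ℝ) (g : X → B) (h : X → X → B),
      N ⊆ E ∧ N.Countable ∧ (∀ x ∈ N, r x ∈ Set.Ioc (0 : ℝ) R) ∧
      AEStronglyMeasurable g μ ∧ (∀ x ∈ N, AEStronglyMeasurable (h x) μ) ∧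
      -- (1) f = g + Σ_{x∈N} h_x
      (∀ᵐ z ∂μ, f z = g z + ∑' x : N, h (x : X) z) ∧
      -- (2) g is concentrated in B(E,R/2) and ‖g‖_∞ ≤ D^2 α
      (∀ᵐ z ∂μ, z ∉ Metric.thickening (R / 2) E → g z = 0) ∧
      essSup (fun z => (‖g z‖₊ : ℝ≥0∞)) μ ≤ (D : ℝ≥0∞) ^ 2 * a ∧
      -- (3) ‖g‖_1 ≤ 3 ‖f‖_1
      (∫⁻ z, (‖g z‖₊ : ℝ≥0∞) ∂μ) ≤ 3 * ∫⁻ z, (‖f z‖₊ : ℝ≥0∞) ∂μ ∧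
      -- (4) h_x concentrated in B(x,r x) ⊆ B(E,R/2), and measure bound
      (∀ x ∈ N, (∀ᵐ z ∂μ, z ∉ ball x (r x) → h x z = 0) ∧
        ball x (r x) ⊆ Metric.thickening (R / 2) E) ∧
      (∑' x : N, μ (ball (x : X) (r (x : X)))) ≤
        (D : ℝ≥0∞) ^ 6 * (∫⁻ z, (‖f z‖₊ : ℝ≥0∞) ∂μ) / a ∧
      -- (5) mean zero
      (∀ x ∈ N, ∫ z, h x z ∂μ = 0) ∧
      -- (6) L^∞ and L^1 bounds for the h_x
      (∀ x ∈ N, essSup (fun z => (‖h x z‖₊ : ℝ≥0∞)) μ ≤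
        2 * essSup (fun z => (‖f z‖₊ : ℝ≥0∞)) μ) ∧
      (∑' x : N, ∫⁻ z, (‖h (x : X) z‖₊ : ℝ≥0∞) ∂μ) ≤ 2 * ∫⁻ z, (‖f z‖₊ : ℝ≥0∞) ∂μ ∧
      -- (7) bounded overlap
      (∀ z : X, ∑' x : N, (ball (x : X) (r (x : X))).indicator (1 : X → ℝ≥0∞) z ≤
        (D : ℝ≥0∞) ^ 5) := by
  have hL : 0 < 6 * R := by positivity
  have hdbl : ∀ (x : X) (r : ℝ), 0 < r → r ≤ 6 * R →
      μ (ball x (2 * r)) ≤ (D : ℝ≥0∞) * μ (ball x r) := fun x r h0 h1 =>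
    hD x r ⟨h0, h1.trans (by nlinarith)⟩
  have hD1' : (1 : ℝ≥0∞) ≤ D := by exact_mod_cast hD1
  have hfin : ∀ (x : X) (r : ℝ), r ≤ 12 * R → μ (ball x r) < ⊤ := fun x r hr =>
    measure_ball_lt_top hdbl hL x (by linarith)
  have : SecondCountableTopology X := secondCountableTopology_of_isSeparable_ball hR fun x =>
    isSeparable_ball_of_measure_lt_top hsupp (show R < 2 * R by linarith)
      (hfin x (2 * R) (by linarith))
  simp only [← enorm_eq_nnnorm] at ha ⊢
  have hdist : ∀ x ∈ E, ∀ y ∈ E, dist x y < R := fun x hx y hy => by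
    have := (Metric.edist_le_ediam_of_mem hx hy).trans_lt hEd
    rwa [edist_dist, ENNReal.ofReal_lt_ofReal_iff hR] at this
  have hEfin : μ E ≠ ⊤ := by
    obtain ⟨x, hx⟩ := nonempty_of_measure_ne_zero hEpos.ne'
    exact ((measure_mono fun y hy => hdist y hy x hx).trans_lt (hfin x R (by linarith))).ne
  have ha0 : a ≠ 0 := (bot_le.trans_lt ha).ne'
  set Ω := maximalSuperlevelSet μ f D (2 * R) a with hΩ
  have hΩo : IsOpen Ω := isOpen_maximalSuperlevelSet
  have hweak : a * μ Ω ≤ (D : ℝ≥0∞) ^ 3 * ∫⁻ z, ‖f z‖ₑ ∂μ :=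
    mul_measure_maximalSuperlevelSet_le hdbl (by linarith)
  obtain ⟨w, hwE, hwΩ⟩ : ∃ w ∈ E, w ∉ Ω := by
    by_contra! hsub
    rw [ENNReal.div_lt_iff (.inl hEpos.ne') (.inl hEfin)] at ha
    refine ha.not_ge ?_
    calc a * μ E ≤ a * μ Ω := by gcongr; exact hsub
      _ ≤ (D : ℝ≥0∞) ^ 3 * ∫⁻ z, ‖f z‖ₑ ∂μ := hweak
      _ ≤ (D : ℝ≥0∞) ^ 4 * ∫⁻ z, ‖f z‖ₑ ∂μ := by
        gcongr
        norm_num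
  have hΩc : Ωᶜ.Nonempty := ⟨w, hwΩ⟩
  set δ : X → ℝ := fun x => infDist x Ωᶜ with hδ
  have hδR : ∀ x ∈ E, δ x < R := fun x hx =>
    (infDist_le_dist_of_mem hwΩ).trans_lt (hdist x hx w hwE)
  obtain ⟨N, hNA, hNc, hNdisj, hcov⟩ := exists_whitney_balls (A := E ∩ Ω) (R := R) hΩo hΩc
    inter_subset_right fun x hx => (hδR x hx.1).le
  have hNE : N ⊆ E := hNA.trans inter_subset_left
  have hδ0 : ∀ x ∈ N, 0 < δ x := fun x hx =>
    (hΩo.isClosed_compl.notMem_iff_infDist_pos hΩc).1 (not_not.2 (hNA hx).2)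
  obtain ⟨Q, hQm, hSQ, hQT, hQd, hQcov⟩ := exists_pairwiseDisjoint_between hNc
    (S := fun x => ball x (δ x / 7)) (T := fun x => ball x (δ x / 2))
    (fun _ _ => measurableSet_ball) (fun _ _ => measurableSet_ball)
    (fun x hx => ball_subset_ball (by linarith [hδ0 x hx])) hNdisj
  have hQ0 : ∀ x ∈ N, μ (Q x) ≠ 0 := fun x hx =>
    ((hsupp x _ (by linarith [hδ0 x hx])).trans_le (measure_mono (hSQ x hx))).ne'
  have hQfin : ∀ x ∈ N, μ (Q x) ≠ ⊤ := fun x hx =>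
    ((measure_mono (hQT x hx)).trans_lt (hfin x _ (by linarith [hδR x (hNE hx)]))).ne
  have hQavg : ∀ x ∈ N, ‖⨍ z in Q x, f z ∂μ‖ₑ ≤ (D : ℝ≥0∞) ^ 2 * a := fun x hx => by
    have hx0 := hδ0 x hx
    have hxR := hδR x (hNE hx)
    obtain ⟨v, hv, hxv⟩ := (infDist_lt_iff hΩc).1 (show δ x < 2 ^ 3 * (δ x / 7) by linarith)
    refine enorm_setAverage_le (hQ0 x hx) (hQfin x hx) ?_
    rw [← ENNReal.mul_le_mul_iff_right (a := (D : ℝ≥0∞)) (zero_lt_one.trans_le hD1').ne' (by simp)]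
    calc (D : ℝ≥0∞) * ∫⁻ z in Q x, ‖f z‖ₑ ∂μ
        ≤ (D : ℝ≥0∞) * ∫⁻ z in ball x (2 ^ 3 * (δ x / 7)), ‖f z‖ₑ ∂μ := by
          gcongr
          exact (hQT x hx).trans (ball_subset_ball (by linarith))
      _ ≤ a * μ (ball x (2 ^ 3 * (δ x / 7))) :=
          mul_lintegral_ball_le_of_notMem_maximalSuperlevelSet hv (mem_ball'.2 hxv) (by linarith)
      _ ≤ a * ((D : ℝ≥0∞) ^ 3 * μ (ball x (δ x / 7))) := by
          gcongr
          exact measure_ball_two_pow_mul_le hdbl x 3 (by linarith) (by linarith)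
      _ ≤ a * ((D : ℝ≥0∞) ^ 3 * μ (Q x)) := by gcongr; exact hSQ x hx
      _ = (D : ℝ≥0∞) * ((D : ℝ≥0∞) ^ 2 * a * μ (Q x)) := by ring
  have hthick : ∀ x ∈ N, ball x (δ x / 2) ⊆ thickening (R / 2) E := fun x hx z hz =>
    mem_thickening_iff.2 ⟨x, hNE hx, hz.trans (by linarith [hδR x (hNE hx)])⟩
  refine ⟨N, fun x => δ x / 2, fun z => f z - ∑' y : N, fluctuationOn μ f (Q y) z,
    fun x => fluctuationOn μ f (Q x), hNE, hNc,
    fun x hx => ⟨by linarith [hδ0 x hx], by linarith [hδ0 x hx, hδR x (hNE hx)]⟩,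
    aestronglyMeasurable_sub_tsum_fluctuationOn hNc hQm hQd hf.1,
    fun x hx => aestronglyMeasurable_fluctuationOn hf.1 (hQm x hx),
    .of_forall fun z => (sub_add_cancel _ _).symm, ?_, ?_,
    lintegral_enorm_sub_tsum_fluctuationOn_le hNc hQm hQd hf.1 hQ0 hQfin,
    fun x hx => ⟨.of_forall fun z hz => indicator_of_notMem (fun h => hz (hQT x hx h)) _,
      hthick x hx⟩, ?_, fun x hx => integral_fluctuationOn (hQm x hx) (hQfin x hx),
    fun x hx => essSup_enorm_fluctuationOn_le (hQ0 x hx) (hQfin x hx),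
    tsum_lintegral_enorm_fluctuationOn_le hNc hQm hQd hQ0 hQfin, fun z => ?_⟩
  · filter_upwards [hfE] with z hz hzE
    have hzU : z ∉ ⋃ x ∈ N, Q x := fun h => by
      obtain ⟨x, hx, hzx⟩ := mem_iUnion₂.1 h
      exact hzE (hthick x hx (hQT x hx hzx))
    rw [tsum_fluctuationOn_of_notMem hzU, sub_zero]
    exact hz fun h => hzE (self_subset_thickening (by positivity) E h)
  · refine essSup_le_of_ae_le _ ?_
    filter_upwards [hfE, ae_enorm_le_of_notMem_maximalSuperlevelSet (ρ := 2 * R) (a := a) hsupp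
      (zero_lt_one.trans_le hD1).ne' hdbl hL (by positivity) hf] with z hz hzΩ
    by_cases hzU : z ∈ ⋃ x ∈ N, Q x
    · obtain ⟨x, hx, hzx⟩ := mem_iUnion₂.1 hzU
      rw [tsum_fluctuationOn_of_mem hQd hx hzx, _root_.sub_sub_cancel]
      exact hQavg x hx
    · rw [tsum_fluctuationOn_of_notMem hzU, sub_zero]
      by_cases hzE : z ∈ E
      · refine (hzΩ fun h => hzU (hQcov (hcov ⟨hzE, h⟩))).trans ?_
        exact le_mul_of_one_le_left' (one_le_pow₀ hD1')
      · simp [hz hzE]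
  · rw [ENNReal.le_div_iff_mul_le (.inl ha0) (.inl ha')]
    have hsub : ⋃ x ∈ N, ball x (δ x / 7) ⊆ Ω := iUnion₂_subset fun x hx z hz =>
      not_not.1 (notMem_of_dist_lt_infDist (s := Ωᶜ) (x := x)
        ((mem_ball'.1 hz).trans (by linarith [hδ0 x hx])))
    calc (∑' x : N, μ (ball (x : X) (δ x / 2))) * a
        ≤ (∑' x : N, (D : ℝ≥0∞) ^ 2 * μ (ball (x : X) (δ x / 7))) * a := by
          gcongr with x
          have hx0 := hδ0 x x.2
          refine (measure_mono (ball_subset_ball ?_)).trans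
            (measure_ball_two_pow_mul_le hdbl x 2 (by linarith) ?_)
          · linarith
          · linarith [hδR x (hNE x.2)]
      _ = (D : ℝ≥0∞) ^ 2 * (a * μ (⋃ x ∈ N, ball x (δ x / 7))) := by
          rw [ENNReal.tsum_mul_left, measure_biUnion hNc hNdisj fun _ _ => measurableSet_ball]
          ring
      _ ≤ (D : ℝ≥0∞) ^ 2 * (a * μ Ω) := by gcongr
      _ ≤ (D : ℝ≥0∞) ^ 2 * ((D : ℝ≥0∞) ^ 3 * ∫⁻ z, ‖f z‖ₑ ∂μ) := by gcongr
      _ = (D : ℝ≥0∞) ^ 5 * ∫⁻ z, ‖f z‖ₑ ∂μ := by ring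
      _ ≤ (D : ℝ≥0∞) ^ 6 * ∫⁻ z, ‖f z‖ₑ ∂μ := by
          gcongr
          norm_num
  · classical
    rw [ENNReal.tsum_eq_iSup_sum]
    refine iSup_le fun s => ?_
    let s' : Finset X := {x ∈ s.map (Function.Embedding.subtype _) | z ∈ ball x (δ x / 2)}
    have hs'N : ∀ x ∈ s', x ∈ N := fun x hx => by
      obtain ⟨y, -, rfl⟩ := Finset.mem_map.1 (Finset.mem_filter.1 hx).1
      exact y.2
    have hsum : ∑ x ∈ s, (ball (x : X) (δ x / 2)).indicator (1 : X → ℝ≥0∞) z = s'.card := by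
      rw [Finset.card_filter, Finset.sum_map]
      push_cast
      exact Finset.sum_congr rfl fun x _ => by simp [indicator_apply]
    rw [hsum]
    rcases s'.eq_empty_or_nonempty with h | h
    · simp [h]
    · exact card_le_of_mem_whitney_balls hsupp hdbl hL h (fun x hx => hδ0 x (hs'N x hx))
        (fun x hx => by linarith [hδR x (hNE (hs'N x hx))])
        (fun x hx => (Finset.mem_filter.1 hx).2) (hNdisj.subset hs'N)
end

section
/- (Quantitative Marcinkiewicz interpolation) Let (Y_j, M_j, ν_j), j=1,2, be measure spaces, B_1, B_2 Banach spaces, V a vector space of ν_1-measurable B_1-valued maps on Y_1 closed under multiplication by bounded scalar functions, and T a linear operator from V into ν_2-measurable B_2-valued maps on Y_2. Take r ∈ (1,∞] and suppose A, B > 0 are such that ν_2({ |Tf| > λ }) ≤ A ‖f‖_{L^1(ν_1;B_1)}/λ for all f ∈ V and λ > 0, and ‖Tf‖_{L^r(ν_2;B_2)} ≤ B ‖f‖_{L^r(ν_1;B_1)} for all f ∈ V. Then for every p ∈ (1,r] and every f ∈ V, ‖Tf‖_{L^p(ν_2;B_2)} ≤ 2 φ(r,p) A^{r'(1/p − 1/r)}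 B^{r'/p'} ‖f‖_{L^p(ν_1;B_1)}, where φ(r,p) = inf_{q ∈ (1,p)} ( q' + 1/(r/q − 1) )^{(1/p − 1/r)/(1 − q/r)}. -/
open MeasureTheory Set ENNReal NNReal

/-- `φ(r,p)` for finite `r`: `inf_{q ∈ (1,p)} (q' + 1/(r/q − 1))^{(1/p − 1/r)/(1 − q/r)}`. -/
noncomputable def phiF (r p : ℝ) : ℝ :=
  sInf ((fun q : ℝ =>
    (q / (q - 1) + 1 / (r / q - 1)) ^ ((1 / p - 1 / r) / (1 - q / r))) '' Set.Ioo 1 p)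

/-- `φ(∞,p) = inf_{q ∈ (1,p)} (q')^{1/p}`. -/
noncomputable def phiTop (p : ℝ) : ℝ :=
  sInf ((fun q : ℝ => (q / (q - 1)) ^ (1 / p)) '' Set.Ioo 1 p)

/-- `φ(r,p)` for `r ∈ (1,∞]`. -/
noncomputable def phiE (r : ℝ≥0∞) (p : ℝ) : ℝ :=
  if r = ∞ then phiTop p else phiF r.toReal p

/-- The conjugate exponent `r'` of `r ∈ (1,∞]` as a real number. -/
noncomputable def conjR (r : ℝ≥0∞) : ℝ :=
  if r = ∞ then 1 else r.toReal / (r.toReal - 1)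

theorem lintegral_lintegral_swap_of_finite_superlevel {Y : Type*} [MeasurableSpace Y]
    {μ : Measure Y} {h : Y → ℝ} (hh : AEMeasurable h μ) (h0 : ∀ y, 0 ≤ h y)
    (hfin : ∀ ε : ℝ, 0 < ε → μ {y | ε < h y} < ∞) {κ : Measure ℝ} [SFinite κ]
    {F : ℝ → ℝ → ℝ≥0∞} (hF : Measurable (Function.uncurry F)) (hF0 : ∀ s, F 0 s = 0) :
    ∫⁻ y, ∫⁻ s, F (h y) s ∂κ ∂μ = ∫⁻ s, ∫⁻ y, F (h y) s ∂μ ∂κ := by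
  set m := μ.map h with hm
  have hnn : ∀ᵐ x ∂m, 0 ≤ x :=
    (ae_map_iff hh measurableSet_Ici).2 (Filter.Eventually.of_forall h0)
  have hσ : SigmaFinite (m.restrict (Ioi 0)) := by
    refine Measure.FiniteSpanningSetsIn.sigmaFinite (C := univ)
      ⟨fun n => Iic 0 ∪ Ioi (1 / ((n : ℝ) + 1)), fun _ => mem_univ _, fun n => ?_, ?_⟩
    · have hn : (0 : ℝ) < 1 / ((n : ℝ) + 1) := by positivity
      rw [Measure.restrict_apply (measurableSet_Iic.union measurableSet_Ioi)]
      calc _ ≤ m (Ioi (1 / ((n : ℝ) + 1))) := by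
            apply measure_mono
            rintro x ⟨hx | hx, hx'⟩
            · exact absurd (mem_Iic.1 hx) (not_le.2 hx')
            · exact hx
        _ = μ {y | 1 / ((n : ℝ) + 1) < h y} := by
            rw [hm, Measure.map_apply_of_aemeasurable hh measurableSet_Ioi]; rfl
        _ < ∞ := hfin _ hn
    · refine eq_univ_of_forall fun x => mem_iUnion.2 ?_
      rcases le_or_gt x 0 with hx | hx
      · exact ⟨0, Or.inl hx⟩
      · obtain ⟨n, hn⟩ := exists_nat_one_div_lt hx
        exact ⟨n, Or.inr hn⟩
  have key : ∀ G : ℝ → ℝ≥0∞, Measurable G → G 0 = 0 →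
      ∫⁻ y, G (h y) ∂μ = ∫⁻ x, G x ∂(m.restrict (Ioi 0)) := by
    intro G hG hG0
    rw [← lintegral_map' hG.aemeasurable hh, ← lintegral_indicator measurableSet_Ioi]
    refine lintegral_congr_ae ?_
    filter_upwards [hnn] with x hx
    rcases hx.eq_or_lt with rfl | hx
    · simp [hG0]
    · simp [indicator, hx]
  rw [key (fun x => ∫⁻ s, F x s ∂κ) hF.lintegral_prod_right (by simp [hF0]),
    lintegral_lintegral_swap hF.aemeasurable]
  refine lintegral_congr fun s => (key (fun x => F x s) ?_ (hF0 s)).symm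
  exact hF.comp measurable_prodMk_right

theorem measure_superlevel_lt_top_of_lintegral_rpow {Y : Type*} [MeasurableSpace Y]
    {μ : Measure Y} {h : Y → ℝ} (hh : AEMeasurable h μ) {p : ℝ} (hp : 0 < p)
    (hfin : ∫⁻ y, ENNReal.ofReal (h y ^ p) ∂μ ≠ ∞) {ε : ℝ} (hε : 0 < ε) :
    μ {y | ε < h y} < ∞ := by
  have h1 := meas_ge_le_lintegral_div (hh.pow_const p).ennreal_ofReal
    (ε := ENNReal.ofReal (ε ^ p)) (by simpa using Real.rpow_pos_of_pos hε p) (by simp)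
  refine (measure_mono ?_).trans_lt (h1.trans_lt (ENNReal.div_lt_top hfin
    (by simpa using Real.rpow_pos_of_pos hε p)))
  intro y hy
  exact ENNReal.ofReal_le_ofReal (Real.rpow_le_rpow hε.le (le_of_lt hy) hp.le)

theorem setLIntegral_Ioi_mul_left_rpow (Ψ : ℝ → ℝ≥0∞) (p : ℝ) {a : ℝ} (ha : 0 < a) :
    ∫⁻ s in Ioi 0, Ψ (a / s) * ENNReal.ofReal (s ^ (p - 1)) =
      ENNReal.ofReal (a ^ p) * ∫⁻ s in Ioi 0, Ψ (1 / s) * ENNReal.ofReal (s ^ (p - 1)) := by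
  have himg : (fun s : ℝ => a * s) '' Ioi 0 = Ioi 0 := by
    rw [image_mul_left_Ioi ha, mul_zero]
  conv_lhs => rw [← himg]
  rw [lintegral_image_eq_lintegral_abs_deriv_mul measurableSet_Ioi
    (f' := fun _ => a) (fun x _ => by
      simpa using ((hasDerivAt_id x).const_mul a).hasDerivWithinAt)
    (fun x _ y _ hxy => mul_left_cancel₀ ha.ne' hxy),
    ← lintegral_const_mul' _ _ ENNReal.ofReal_ne_top]
  refine setLIntegral_congr_fun measurableSet_Ioi fun s hs => ?_
  have hs : (0 : ℝ) < s := hs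
  have e : a / (a * s) = 1 / s := by field_simp
  simp only [e]
  rw [mul_left_comm, mul_left_comm (ENNReal.ofReal (a ^ p)), ← ENNReal.ofReal_mul (by positivity),
    ← ENNReal.ofReal_mul (by positivity), abs_of_pos ha, Real.mul_rpow ha.le hs.le, ← mul_assoc,
    Real.rpow_sub_one ha.ne', mul_div_cancel₀ _ ha.ne']

theorem setLIntegral_Ioi_rpow {e c : ℝ} (he : e < -1) (hc : 0 < c) :
    ∫⁻ t in Ioi c, ENNReal.ofReal (t ^ e) = ENNReal.ofReal (-c ^ (e + 1) / (e + 1)) := by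
  rw [← integral_Ioi_rpow_of_lt he hc, ofReal_integral_eq_lintegral_ofReal
    (integrableOn_Ioi_rpow_of_lt he hc)]
  filter_upwards [ae_restrict_mem measurableSet_Ioi] with t ht
  exact Real.rpow_nonneg (hc.trans ht).le _

theorem setLIntegral_Ioc_rpow {e c : ℝ} (he : -1 < e) (hc : 0 ≤ c) :
    ∫⁻ t in Ioc 0 c, ENNReal.ofReal (t ^ e) = ENNReal.ofReal (c ^ (e + 1) / (e + 1)) := by
  have h1 : ∫ t in Ioc 0 c, t ^ e = c ^ (e + 1) / (e + 1) := by
    rw [← intervalIntegral.integral_of_le hc, integral_rpow (Or.inl he),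
      Real.zero_rpow (by linarith), sub_zero]
  rw [← h1, ofReal_integral_eq_lintegral_ofReal
    ((intervalIntegrable_iff_integrableOn_Ioc_of_le hc).1
      (intervalIntegral.intervalIntegrable_rpow' he))]
  filter_upwards [ae_restrict_mem measurableSet_Ioc] with t ht
  exact Real.rpow_nonneg ht.1.le _

theorem lintegral_large_part {Y : Type*} [MeasurableSpace Y] {μ : Measure Y} {h : Y → ℝ}
    (hh : AEMeasurable h μ) (h0 : ∀ y, 0 ≤ h y) {q γ K : ℝ} (hq : 1 < q) (hγ : 0 < γ)
    (hK : 0 ≤ K) (hfin : ∫⁻ y, ENNReal.ofReal (h y ^ q) ∂μ ≠ ∞) :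
    ∫⁻ t in Ioi 0, (ENNReal.ofReal (K / t) *
        ∫⁻ y, ENNReal.ofReal (if γ * t < h y then h y else 0) ∂μ) * ENNReal.ofReal (t ^ (q - 1)) =
      ENNReal.ofReal (K * γ ^ (1 - q) / (q - 1)) * ∫⁻ y, ENNReal.ofReal (h y ^ q) ∂μ := by
  set F : ℝ → ℝ → ℝ≥0∞ := fun x t =>
    ENNReal.ofReal (if γ * t < x then x else 0) * ENNReal.ofReal (K / t * t ^ (q - 1)) with hFdef
  have hF : Measurable (Function.uncurry F) := by
    refine Measurable.mul (Measurable.ennreal_ofReal (Measurable.ite ?_ ?_ ?_)) ?_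
    · exact measurableSet_lt (by fun_prop) (by fun_prop)
    all_goals fun_prop
  have hswap := lintegral_lintegral_swap_of_finite_superlevel hh h0
    (fun ε hε => measure_superlevel_lt_top_of_lintegral_rpow hh (by linarith) hfin hε)
    (κ := volume.restrict (Ioi 0)) hF (fun s => by simp [hFdef])
  have hL : ∀ t ∈ Ioi (0 : ℝ), (ENNReal.ofReal (K / t) *
        ∫⁻ y, ENNReal.ofReal (if γ * t < h y then h y else 0) ∂μ) * ENNReal.ofReal (t ^ (q - 1)) =
      ∫⁻ y, F (h y) t ∂μ := by
    intro t ht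
    have ht : (0 : ℝ) < t := ht
    simp only [hFdef]
    rw [lintegral_mul_const' _ _ ENNReal.ofReal_ne_top, ENNReal.ofReal_mul (by positivity)]
    ring
  rw [setLIntegral_congr_fun measurableSet_Ioi hL, ← hswap,
    ← lintegral_const_mul' _ _ ENNReal.ofReal_ne_top]
  refine lintegral_congr fun y => ?_
  rcases (h0 y).eq_or_lt with hy | hy
  · simp [hFdef, ← hy, Real.zero_rpow (show q ≠ 0 by linarith)]
  · have e1 : ∀ t ∈ Ioi (0 : ℝ), F (h y) t =
        (Iio (h y / γ)).indicator
          (fun t => ENNReal.ofReal (h y * K) * ENNReal.ofReal (t ^ (q - 2))) t := by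
      intro t ht
      have ht : (0 : ℝ) < t := ht
      by_cases hlt : γ * t < h y
      · have : t ∈ Iio (h y / γ) := by rw [mem_Iio, lt_div_iff₀ hγ]; linarith
        rw [indicator_of_mem this]
        simp only [hFdef, if_pos hlt]
        rw [← ENNReal.ofReal_mul hy.le, ← ENNReal.ofReal_mul (by positivity),
          show q - 2 = q - 1 - 1 by ring, Real.rpow_sub_one ht.ne' (q - 1)]
        congr 1; ring
      · have : t ∉ Iio (h y / γ) := by
          rw [mem_Iio, lt_div_iff₀ hγ]; intro h'; exact hlt (by linarith)
        rw [indicator_of_notMem this]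
        simp [hFdef, if_neg hlt]
    rw [setLIntegral_congr_fun measurableSet_Ioi e1, lintegral_indicator measurableSet_Iio,
      Measure.restrict_restrict measurableSet_Iio, lintegral_const_mul' _ _ ENNReal.ofReal_ne_top,
      inter_comm, Ioi_inter_Iio, ← restrict_Ioo_eq_restrict_Ioc.symm,
      setLIntegral_Ioc_rpow (by linarith) (by positivity), ← ENNReal.ofReal_mul (by positivity),
      ← ENNReal.ofReal_mul (by have := sub_pos.2 hq; positivity)]
    congr 1
    rw [show q - 2 + 1 = q - 1 by ring, Real.div_rpow hy.le hγ.le, Real.rpow_sub_one hy.ne',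
      show 1 - q = -(q - 1) by ring, Real.rpow_neg hγ.le]
    have := sub_pos.2 hq
    field_simp

theorem lintegral_small_part {Y : Type*} [MeasurableSpace Y] {μ : Measure Y} {h : Y → ℝ}
    (hh : AEMeasurable h μ) (h0 : ∀ y, 0 ≤ h y) {q r γ K : ℝ} (hq : 1 < q) (hqr : q < r)
    (hγ : 0 < γ) (hK : 0 ≤ K) (hfin : ∫⁻ y, ENNReal.ofReal (h y ^ q) ∂μ ≠ ∞) :
    ∫⁻ t in Ioi 0, (ENNReal.ofReal ((K / t) ^ r) *
        ∫⁻ y, ENNReal.ofReal (if γ * t < h y then 0 else h y ^ r) ∂μ) *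
          ENNReal.ofReal (t ^ (q - 1)) =
      ENNReal.ofReal (K ^ r * γ ^ (r - q) / (r - q)) * ∫⁻ y, ENNReal.ofReal (h y ^ q) ∂μ := by
  have hr0 : r ≠ 0 := by linarith
  set F : ℝ → ℝ → ℝ≥0∞ := fun x t =>
    ENNReal.ofReal (if γ * t < x then 0 else x ^ r) *
      ENNReal.ofReal ((K / t) ^ r * t ^ (q - 1)) with hFdef
  have hF : Measurable (Function.uncurry F) := by
    refine Measurable.mul (Measurable.ennreal_ofReal (Measurable.ite ?_ ?_ ?_)) ?_
    · exact measurableSet_lt (by fun_prop) (by fun_prop)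
    all_goals fun_prop
  have hswap := lintegral_lintegral_swap_of_finite_superlevel hh h0
    (fun ε hε => measure_superlevel_lt_top_of_lintegral_rpow hh (by linarith) hfin hε)
    (κ := volume.restrict (Ioi 0)) hF (fun s => by simp [hFdef, Real.zero_rpow hr0])
  have hL : ∀ t ∈ Ioi (0 : ℝ), (ENNReal.ofReal ((K / t) ^ r) *
        ∫⁻ y, ENNReal.ofReal (if γ * t < h y then 0 else h y ^ r) ∂μ) *
          ENNReal.ofReal (t ^ (q - 1)) =
      ∫⁻ y, F (h y) t ∂μ := by
    intro t ht
    have ht : (0 : ℝ) < t := ht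
    simp only [hFdef]
    rw [lintegral_mul_const' _ _ ENNReal.ofReal_ne_top, ENNReal.ofReal_mul (by positivity)]
    ring
  rw [setLIntegral_congr_fun measurableSet_Ioi hL, ← hswap,
    ← lintegral_const_mul' _ _ ENNReal.ofReal_ne_top]
  refine lintegral_congr fun y => ?_
  rcases (h0 y).eq_or_lt with hy | hy
  · simp [hFdef, ← hy, Real.zero_rpow (show q ≠ 0 by linarith), Real.zero_rpow hr0]
  · have e1 : ∀ t ∈ Ioi (0 : ℝ), F (h y) t =
        (Ici (h y / γ)).indicator
          (fun t => ENNReal.ofReal (h y ^ r * K ^ r) * ENNReal.ofReal (t ^ (q - 1 - r))) t := by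
      intro t ht
      have ht : (0 : ℝ) < t := ht
      by_cases hlt : γ * t < h y
      · have : t ∉ Ici (h y / γ) := by
          rw [mem_Ici, div_le_iff₀ hγ]; intro h'; linarith
        rw [indicator_of_notMem this]
        simp [hFdef, if_pos hlt]
      · have : t ∈ Ici (h y / γ) := by rw [mem_Ici, div_le_iff₀ hγ]; linarith
        rw [indicator_of_mem this]
        simp only [hFdef, if_neg hlt]
        rw [← ENNReal.ofReal_mul (by positivity), ← ENNReal.ofReal_mul (by positivity),
          Real.rpow_sub ht (q - 1), Real.div_rpow hK ht.le]
        congr 1; ring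
    have hsub : Ici (h y / γ) ∩ Ioi 0 = Ici (h y / γ) :=
      inter_eq_left.2 fun t ht => lt_of_lt_of_le (by positivity : 0 < h y / γ) ht
    rw [setLIntegral_congr_fun measurableSet_Ioi e1, lintegral_indicator measurableSet_Ici,
      Measure.restrict_restrict measurableSet_Ici, lintegral_const_mul' _ _ ENNReal.ofReal_ne_top,
      hsub, ← restrict_Ioi_eq_restrict_Ici,
      setLIntegral_Ioi_rpow (by linarith) (by positivity), ← ENNReal.ofReal_mul (by positivity),
      ← ENNReal.ofReal_mul (by have := sub_pos.2 hqr; positivity)]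
    congr 1
    rw [show q - 1 - r + 1 = q - r by ring, Real.div_rpow hy.le hγ.le,
      Real.rpow_sub hy, show q - r = -(r - q) by ring, Real.rpow_neg hγ.le]
    have := sub_pos.2 hqr
    field_simp

/-- The cheapest way of splitting `x ≥ 0` as `u + v` when `u` costs `u ^ q` and `v` costs `v ^ r`. -/
noncomputable def splitCost (q r x : ℝ) : ℝ≥0∞ :=
  ⨅ n : ℕ, ENNReal.ofReal
    (((TopologicalSpace.denseSeq unitInterval n : ℝ) * x) ^ q +
      ((1 - (TopologicalSpace.denseSeq unitInterval n : ℝ)) * x) ^ r)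

theorem measurable_splitCost (q r : ℝ) : Measurable (splitCost q r) := by
  unfold splitCost
  fun_prop

theorem splitCost_zero {q r : ℝ} (hq : 0 < q) (hr : 0 < r) : splitCost q r 0 = 0 := by
  simp [splitCost, Real.zero_rpow hq.ne', Real.zero_rpow hr.ne']

theorem splitCost_le {q r u v x : ℝ} (hq : 0 < q) (hr : 0 < r) (hu : 0 ≤ u) (hv : 0 ≤ v)
    (hx : 0 ≤ x) (hxuv : x ≤ u + v) : splitCost q r x ≤ ENNReal.ofReal (u ^ q + v ^ r) := by
  rcases hx.eq_or_lt with rfl | hx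
  · simp [splitCost_zero hq hr]
  have huv : 0 < u + v := hx.trans_le hxuv
  have hmem : u / (u + v) ∈ unitInterval :=
    ⟨by positivity, (div_le_one huv).2 (by linarith)⟩
  have hall : ∀ θ : unitInterval,
      splitCost q r x ≤ ENNReal.ofReal (((θ : ℝ) * x) ^ q + ((1 - (θ : ℝ)) * x) ^ r) := by
    intro θ
    refine (TopologicalSpace.denseRange_denseSeq unitInterval).induction_on θ ?_ ?_
    · refine isClosed_le continuous_const (ENNReal.continuous_ofReal.comp ?_)
      exact ((continuous_subtype_val.mul continuous_const).rpow_const fun _ => Or.inr hq.le).add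
        (((continuous_const.sub continuous_subtype_val).mul continuous_const).rpow_const
          fun _ => Or.inr hr.le)
    · exact fun n => iInf_le _ n
  refine (hall ⟨_, hmem⟩).trans (ENNReal.ofReal_le_ofReal (add_le_add ?_ ?_))
  · refine Real.rpow_le_rpow (by positivity) ?_ hq.le
    rw [div_mul_eq_mul_div, div_le_iff₀ huv]
    exact mul_le_mul_of_nonneg_left hxuv hu
  · have e : 1 - u / (u + v) = v / (u + v) := by field_simp; ring
    simp only [e]
    refine Real.rpow_le_rpow (by positivity) ?_ hr.le
    rw [div_mul_eq_mul_div, div_le_iff₀ huv]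
    exact mul_le_mul_of_nonneg_left hxuv hv

theorem le_splitCost {q r δ x : ℝ} (hq : 0 < q) (hr : 0 < r) (hδ : 0 < δ) (hx : δ ≤ x) :
    ENNReal.ofReal (min ((δ / 2) ^ q) ((δ / 2) ^ r)) ≤ splitCost q r x := by
  refine le_iInf fun n => ENNReal.ofReal_le_ofReal ?_
  obtain ⟨h0, h1⟩ := (TopologicalSpace.denseSeq unitInterval n).2
  set θ : ℝ := (TopologicalSpace.denseSeq unitInterval n : ℝ)
  have hx0 : 0 < x := hδ.trans_le hx
  have n1 : 0 ≤ (θ * x) ^ q := Real.rpow_nonneg (by positivity) _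
  have n2 : 0 ≤ ((1 - θ) * x) ^ r := Real.rpow_nonneg (mul_nonneg (by linarith) hx0.le) _
  rcases le_total (1 / 2) θ with h | h
  · have : (δ / 2) ^ q ≤ (θ * x) ^ q := Real.rpow_le_rpow (by positivity) (by nlinarith) hq.le
    exact (min_le_left _ _).trans (by linarith)
  · have : (δ / 2) ^ r ≤ ((1 - θ) * x) ^ r :=
      Real.rpow_le_rpow (by positivity) (by nlinarith) hr.le
    exact (min_le_right _ _).trans (by linarith)

theorem splitCost_le_rpow {q p r x : ℝ} (hq : 0 < q) (hqp : q ≤ p) (hpr : p ≤ r) (hx : 0 ≤ x) :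
    splitCost q r x ≤ ENNReal.ofReal (x ^ p) := by
  have hr : 0 < r := by linarith
  rcases hx.eq_or_lt with rfl | hx
  · simp [splitCost_zero hq hr]
  rcases le_total 1 x with h | h
  · refine (splitCost_le hq hr hx.le le_rfl hx.le (by simp)).trans (ENNReal.ofReal_le_ofReal ?_)
    rw [Real.zero_rpow hr.ne', add_zero]
    exact Real.rpow_le_rpow_of_exponent_le h hqp
  · refine (splitCost_le hq hr le_rfl hx.le hx.le (by simp)).trans (ENNReal.ofReal_le_ofReal ?_)
    rw [Real.zero_rpow hq.ne', zero_add]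
    exact Real.rpow_le_rpow_of_exponent_ge hx h hpr

theorem exists_measurable_almost_optimal_split {q r : ℝ} (hq : 0 < q) (hr : 0 < r) {ρ : ℝ≥0∞}
    (hρ : 1 < ρ) :
    ∃ g : ℝ → ℝ, Measurable g ∧ (∀ x, g x ∈ Icc (0 : ℝ) 1) ∧ ∀ x, 0 ≤ x →
      ENNReal.ofReal ((g x * x) ^ q + ((1 - g x) * x) ^ r) ≤ ρ * splitCost q r x := by
  classical
  have hex : ∀ x : ℝ, ∃ n : ℕ, x ≤ 0 ∨ ENNReal.ofReal
      (((TopologicalSpace.denseSeq unitInterval n : ℝ) * x) ^ q +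
        ((1 - (TopologicalSpace.denseSeq unitInterval n : ℝ)) * x) ^ r) ≤ ρ * splitCost q r x := by
    intro x
    rcases le_or_gt x 0 with hx | hx
    · exact ⟨0, Or.inl hx⟩
    have hpos : splitCost q r x ≠ 0 := by
      refine (lt_of_lt_of_le ?_ (le_splitCost hq hr hx le_rfl)).ne'
      simp only [ENNReal.ofReal_pos, lt_min_iff]
      constructor <;> positivity
    have htop : splitCost q r x ≠ ∞ :=
      ((splitCost_le hq hr hx.le le_rfl hx.le (by simp)).trans_lt ENNReal.ofReal_lt_top).ne
    have hlt : splitCost q r x < ρ * splitCost q r x := by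
      conv_lhs => rw [← one_mul (splitCost q r x)]
      exact ENNReal.mul_lt_mul_left hpos htop hρ
    obtain ⟨n, hn⟩ := iInf_lt_iff.1 hlt
    exact ⟨n, Or.inr hn.le⟩
  have hmeas : Measurable fun x => Nat.find (hex x) := by
    refine measurable_find hex fun n => ?_
    exact (measurableSet_le measurable_id measurable_const).union
      (measurableSet_le (by fun_prop) ((measurable_splitCost q r).const_mul ρ))
  refine ⟨fun x => (TopologicalSpace.denseSeq unitInterval (Nat.find (hex x)) : ℝ), ?_,
    fun x => (TopologicalSpace.denseSeq unitInterval (Nat.find (hex x))).2, fun x hx => ?_⟩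
  · exact (measurable_from_nat (f := fun n : ℕ =>
      (TopologicalSpace.denseSeq unitInterval n : ℝ))).comp hmeas
  · rcases Nat.find_spec (hex x) with h | h
    · obtain rfl := le_antisymm h hx
      simp [Real.zero_rpow hq.ne', Real.zero_rpow hr.ne']
    · exact h

theorem setLIntegral_splitCost_ne_zero {q r : ℝ} (hq : 0 < q) (hr : 0 < r) (p : ℝ) :
    ∫⁻ s in Ioi 0, splitCost q r (1 / s) * ENNReal.ofReal (s ^ (p - 1)) ≠ 0 := by
  have hm := measurable_splitCost q r
  refine ((setLIntegral_pos_iff (by fun_prop)).2 ?_).ne'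
  have : Function.support (fun s : ℝ => splitCost q r (1 / s) * ENNReal.ofReal (s ^ (p - 1))) ∩
      Ioi 0 = Ioi 0 := by
    refine inter_eq_right.2 fun s hs => mul_ne_zero ?_ ?_
    · have hs : (0 : ℝ) < s := hs
      refine (lt_of_lt_of_le ?_ (le_splitCost hq hr (by positivity : 0 < 1 / s) le_rfl)).ne'
      simp only [ENNReal.ofReal_pos, lt_min_iff]
      constructor <;> positivity
    · simpa using Real.rpow_pos_of_pos hs _
  rw [this]
  simp

theorem setLIntegral_splitCost_ne_top {q p r : ℝ} (hq : 0 < q) (hqp : q < p) (hpr : p < r) :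
    ∫⁻ s in Ioi 0, splitCost q r (1 / s) * ENNReal.ofReal (s ^ (p - 1)) ≠ ∞ := by
  have hr : 0 < r := by linarith
  have hb : ∀ a : ℝ, q ≤ a → a ≤ r → ∀ s : ℝ, 0 < s →
      splitCost q r (1 / s) * ENNReal.ofReal (s ^ (p - 1)) ≤
        ENNReal.ofReal (s ^ (p - 1 - a)) := by
    intro a h1 h2 s hs
    refine (mul_le_mul_left (splitCost_le_rpow hq h1 h2 (by positivity)) _).trans ?_
    rw [← ENNReal.ofReal_mul (by positivity), Real.rpow_sub hs (p - 1), Real.div_rpow zero_le_one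
      hs.le, Real.one_rpow]
    exact ENNReal.ofReal_le_ofReal (le_of_eq (by ring))
  rw [← Ioc_union_Ioi_eq_Ioi (zero_le_one' ℝ),
    lintegral_union measurableSet_Ioi (Ioc_disjoint_Ioi le_rfl)]
  refine ENNReal.add_ne_top.2 ⟨?_, ?_⟩
  · refine ((setLIntegral_mono_ae (by fun_prop) (Filter.Eventually.of_forall fun s hs =>
      hb q le_rfl (by linarith) s hs.1)).trans_lt ?_).ne
    rw [setLIntegral_Ioc_rpow (by linarith) zero_le_one]
    exact ENNReal.ofReal_lt_top
  · refine ((setLIntegral_mono_ae (by fun_prop) (Filter.Eventually.of_forall fun s (hs : s ∈ Ioi 1) =>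
      hb r (by linarith) le_rfl s (zero_lt_one.trans (mem_Ioi.1 hs)))).trans_lt ?_).ne
    rw [setLIntegral_Ioi_rpow (by linarith) zero_lt_one]
    exact ENNReal.ofReal_lt_top

theorem lintegral_lintegral_splitCost {Y : Type*} [MeasurableSpace Y] {μ : Measure Y} {h : Y → ℝ}
    (hh : AEMeasurable h μ) (h0 : ∀ y, 0 ≤ h y)
    (hfin : ∀ ε : ℝ, 0 < ε → μ {y | ε < h y} < ∞) {q p r : ℝ} (hq : 0 < q) (hqp : q < p)
    (hpr : p < r) :
    ∫⁻ s in Ioi 0, (∫⁻ y, splitCost q r (h y / s) ∂μ) * ENNReal.ofReal (s ^ (p - 1)) =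
      (∫⁻ s in Ioi 0, splitCost q r (1 / s) * ENNReal.ofReal (s ^ (p - 1))) *
        ∫⁻ y, ENNReal.ofReal (h y ^ p) ∂μ := by
  have hr : 0 < r := by linarith
  have hm := measurable_splitCost q r
  have hswap := lintegral_lintegral_swap_of_finite_superlevel hh h0 hfin
    (κ := volume.restrict (Ioi 0))
    (F := fun x s => splitCost q r (x / s) * ENNReal.ofReal (s ^ (p - 1)))
    (by simp only [Function.uncurry_def]; fun_prop) (fun s => by simp [splitCost_zero hq hr])
  simp only [lintegral_mul_const' _ _ ENNReal.ofReal_ne_top] at hswap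
  rw [← hswap, ← lintegral_const_mul' _ _ (setLIntegral_splitCost_ne_top hq hqp hpr)]
  refine lintegral_congr fun y => ?_
  rcases (h0 y).eq_or_lt with hy | hy
  · simp [← hy, splitCost_zero hq hr, Real.zero_rpow (hq.trans hqp).ne']
  · rw [setLIntegral_Ioi_mul_left_rpow _ _ hy, mul_comm]

theorem lintegral_rpow_interpolate {Y₁ Y₂ : Type*} [MeasurableSpace Y₁] [MeasurableSpace Y₂]
    {μ : Measure Y₁} {ν : Measure Y₂} {h : Y₁ → ℝ} {u : Y₂ → ℝ}
    (hh : AEMeasurable h μ) (h0 : ∀ y, 0 ≤ h y) (hu : AEMeasurable u ν) (u0 : ∀ y, 0 ≤ u y)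
    {q p r c k : ℝ} (hq : 0 < q) (hqp : q < p) (hpr : p < r) (hc : 0 < c) (hk : 0 < k)
    (hsplit : ∀ g : ℝ → ℝ, Measurable g → (∀ x, g x ∈ Icc (0 : ℝ) 1) →
      ∃ v w : Y₂ → ℝ, (∀ y, 0 ≤ v y) ∧ (∀ y, 0 ≤ w y) ∧ AEMeasurable v ν ∧
        (∀ᵐ y ∂ν, u y ≤ v y + w y) ∧
        ∫⁻ y, ENNReal.ofReal (v y ^ q) ∂ν ≤
          ENNReal.ofReal (c * k ^ (-q)) * ∫⁻ y, ENNReal.ofReal ((g (h y) * h y) ^ q) ∂μ ∧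
        ∫⁻ y, ENNReal.ofReal (w y ^ r) ∂ν ≤
          ENNReal.ofReal (c * k ^ (-r)) * ∫⁻ y, ENNReal.ofReal (((1 - g (h y)) * h y) ^ r) ∂μ)
    (hfin : ∫⁻ y, ENNReal.ofReal (h y ^ p) ∂μ ≠ ∞) :
    ∫⁻ y, ENNReal.ofReal (u y ^ p) ∂ν ≤
      ENNReal.ofReal (c * k ^ (-p)) * ∫⁻ y, ENNReal.ofReal (h y ^ p) ∂μ := by
  have hp : 0 < p := by linarith
  have hr : 0 < r := by linarith
  have hm := measurable_splitCost q r
  have step : ∀ ρ : ℝ≥0∞, 1 < ρ → ρ ≠ ∞ → ∀ s : ℝ, 0 < s →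
      ∫⁻ y, splitCost q r (u y / s) ∂ν ≤
        ENNReal.ofReal c * ρ * ∫⁻ y, splitCost q r (h y / k / s) ∂μ := by
    intro ρ hρ hρt s hs
    obtain ⟨g, hg, hgI, hgle⟩ := exists_measurable_almost_optimal_split hq hr hρ
    obtain ⟨v, w, v0, w0, hv, huvw, hvq, hwr⟩ := hsplit (fun x => g (x / k / s)) (by fun_prop)
      (fun x => hgI _)
    have scale : ∀ (a x : ℝ), 0 ≤ x → ENNReal.ofReal (s ^ (-a)) * (ENNReal.ofReal (c * k ^ (-a)) *
        ENNReal.ofReal (x ^ a)) = ENNReal.ofReal c * ENNReal.ofReal ((x / k / s) ^ a) := by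
      intro a x hx
      rw [← ENNReal.ofReal_mul (by positivity), ← ENNReal.ofReal_mul (by positivity),
        ← ENNReal.ofReal_mul hc.le, Real.div_rpow (by positivity) hs.le, Real.div_rpow hx hk.le,
        Real.rpow_neg hs.le, Real.rpow_neg hk.le]
      congr 1
      field_simp
    have scale' : ∀ (a x : ℝ), 0 ≤ x → ENNReal.ofReal ((x / s) ^ a) =
        ENNReal.ofReal (s ^ (-a)) * ENNReal.ofReal (x ^ a) := by
      intro a x hx
      rw [← ENNReal.ofReal_mul (by positivity), Real.div_rpow hx hs.le, Real.rpow_neg hs.le]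
      congr 1
      field_simp
    calc ∫⁻ y, splitCost q r (u y / s) ∂ν
        ≤ ∫⁻ y, (ENNReal.ofReal (s ^ (-q)) * ENNReal.ofReal (v y ^ q) +
            ENNReal.ofReal (s ^ (-r)) * ENNReal.ofReal (w y ^ r)) ∂ν := by
          refine lintegral_mono_ae ?_
          filter_upwards [huvw] with y hy
          have hv0 := v0 y
          have hw0 := w0 y
          have hu0 := u0 y
          rw [← scale' q _ (v0 y), ← scale' r _ (w0 y),
            ← ENNReal.ofReal_add (by positivity) (by positivity)]
          refine splitCost_le hq hr (by positivity) (by positivity) (by positivity) ?_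
          rw [← add_div]
          gcongr
      _ = ENNReal.ofReal (s ^ (-q)) * ∫⁻ y, ENNReal.ofReal (v y ^ q) ∂ν +
            ENNReal.ofReal (s ^ (-r)) * ∫⁻ y, ENNReal.ofReal (w y ^ r) ∂ν := by
          rw [lintegral_add_left' (by fun_prop), lintegral_const_mul' _ _ ENNReal.ofReal_ne_top,
            lintegral_const_mul' _ _ ENNReal.ofReal_ne_top]
      _ ≤ ENNReal.ofReal (s ^ (-q)) * (ENNReal.ofReal (c * k ^ (-q)) *
              ∫⁻ y, ENNReal.ofReal ((g (h y / k / s) * h y) ^ q) ∂μ) +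
            ENNReal.ofReal (s ^ (-r)) * (ENNReal.ofReal (c * k ^ (-r)) *
              ∫⁻ y, ENNReal.ofReal (((1 - g (h y / k / s)) * h y) ^ r) ∂μ) := by gcongr
      _ = ∫⁻ y, ENNReal.ofReal c * ENNReal.ofReal ((g (h y / k / s) * (h y / k / s)) ^ q +
            ((1 - g (h y / k / s)) * (h y / k / s)) ^ r) ∂μ := by
          rw [← lintegral_const_mul' _ _ ENNReal.ofReal_ne_top,
            ← lintegral_const_mul' _ _ ENNReal.ofReal_ne_top,
            ← lintegral_const_mul' _ _ ENNReal.ofReal_ne_top,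
            ← lintegral_const_mul' _ _ ENNReal.ofReal_ne_top, ← lintegral_add_left' (by
              have : AEMeasurable (fun y => g (h y / k / s)) μ :=
                hg.comp_aemeasurable (by fun_prop)
              fun_prop)]
          refine lintegral_congr fun y => ?_
          have hy := h0 y
          obtain ⟨g0, g1⟩ := hgI (h y / k / s)
          have g1' := sub_nonneg.2 g1
          rw [scale _ _ (by positivity), scale _ _ (by positivity), ← mul_add,
            ← ENNReal.ofReal_add (by positivity) (by positivity)]
          simp only [mul_div_assoc]
      _ ≤ ∫⁻ y, ENNReal.ofReal c * ρ * splitCost q r (h y / k / s) ∂μ := by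
          refine lintegral_mono fun y => ?_
          have hy := h0 y
          rw [mul_assoc]
          exact mul_le_mul_right (hgle _ (by positivity)) _
      _ = _ := lintegral_const_mul' _ _ (ENNReal.mul_ne_top ENNReal.ofReal_ne_top hρt)
  have hhk : ∫⁻ y, ENNReal.ofReal ((h y / k) ^ p) ∂μ =
      ENNReal.ofReal (k ^ (-p)) * ∫⁻ y, ENNReal.ofReal (h y ^ p) ∂μ := by
    rw [← lintegral_const_mul' _ _ ENNReal.ofReal_ne_top]
    refine lintegral_congr fun y => ?_
    rw [← ENNReal.ofReal_mul (by positivity), Real.div_rpow (h0 y) hk.le, Real.rpow_neg hk.le]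
    congr 1
    field_simp
  have hkfin : ∫⁻ y, ENNReal.ofReal ((h y / k) ^ p) ∂μ ≠ ∞ := by
    rw [hhk]
    exact ENNReal.mul_ne_top ENNReal.ofReal_ne_top hfin
  have hk0 : ∀ y, 0 ≤ h y / k := fun y => div_nonneg (h0 y) hk.le
  have ufin : ∀ ε : ℝ, 0 < ε → ν {y | ε < u y} < ∞ := by
    intro ε hε
    have hLpos : ENNReal.ofReal (min ((ε / 2) ^ q) ((ε / 2) ^ r)) ≠ 0 := by
      refine (ENNReal.ofReal_pos.2 (lt_min ?_ ?_)).ne' <;> positivity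
    have hcost : ∫⁻ y, splitCost q r (u y) ∂ν ≠ ∞ := by
      have h1 := step 2 (by norm_num) (by norm_num) 1 one_pos
      simp only [div_one] at h1
      refine (h1.trans_lt (ENNReal.mul_lt_top (ENNReal.mul_lt_top ENNReal.ofReal_lt_top
        (by norm_num)) (lt_of_le_of_lt ?_ hkfin.lt_top))).ne
      exact lintegral_mono fun y => splitCost_le_rpow hq hqp.le hpr.le (hk0 y)
    refine (measure_mono fun y (hy : ε < u y) => ?_).trans_lt
      ((meas_ge_le_lintegral_div (hm.comp_aemeasurable hu) hLpos
        ENNReal.ofReal_ne_top).trans_lt (ENNReal.div_lt_top hcost hLpos))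
    exact le_splitCost hq hr hε hy.le
  set C := ∫⁻ s in Ioi 0, splitCost q r (1 / s) * ENNReal.ofReal (s ^ (p - 1)) with hC
  have hCt : C ≠ ∞ := setLIntegral_splitCost_ne_top hq hqp hpr
  have hC0 : C ≠ 0 := setLIntegral_splitCost_ne_zero hq hr p
  have main : ∀ ρ : ℝ≥0∞, 1 < ρ → ρ ≠ ∞ → ∫⁻ y, ENNReal.ofReal (u y ^ p) ∂ν ≤
      ρ * (ENNReal.ofReal (c * k ^ (-p)) * ∫⁻ y, ENNReal.ofReal (h y ^ p) ∂μ) := by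
    intro ρ hρ hρt
    rw [← ENNReal.mul_le_mul_iff_right hC0 hCt, ← lintegral_lintegral_splitCost hu u0 ufin hq hqp hpr]
    calc _ ≤ ∫⁻ s in Ioi 0, ENNReal.ofReal c * ρ *
              ((∫⁻ y, splitCost q r (h y / k / s) ∂μ) * ENNReal.ofReal (s ^ (p - 1))) := by
          refine lintegral_mono_ae ?_
          filter_upwards [ae_restrict_mem measurableSet_Ioi] with s hs
          rw [← mul_assoc]
          exact mul_le_mul_left (step ρ hρ hρt s hs) _
      _ = _ := by
          rw [lintegral_const_mul' _ _ (ENNReal.mul_ne_top ENNReal.ofReal_ne_top hρt),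
            lintegral_lintegral_splitCost (hh.div_const k) hk0
              (fun ε hε => measure_superlevel_lt_top_of_lintegral_rpow (hh.div_const k) hp hkfin hε)
              hq hqp hpr, hhk, ENNReal.ofReal_mul hc.le]
          ring
  by_contra! hlt
  rcases eq_or_ne (ENNReal.ofReal (c * k ^ (-p)) * ∫⁻ y, ENNReal.ofReal (h y ^ p) ∂μ) 0
    with hY | hY
  · have := main 2 (by norm_num) (by norm_num)
    rw [hY, mul_zero] at this
    rw [hY] at hlt
    exact absurd hlt (not_lt.2 this)
  · have hYt := ENNReal.mul_ne_top (ENNReal.ofReal_ne_top (r := c * k ^ (-p))) hfin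
    obtain ⟨ρ, h1, h2⟩ := exists_between
      ((ENNReal.lt_div_iff_mul_lt (Or.inl hY) (Or.inl hYt)).2 (by rwa [one_mul]))
    exact absurd (ENNReal.mul_lt_of_lt_div h2) (not_lt.2 (main ρ h1 h2.ne_top))

theorem lintegral_rpow_le_of_measure_superlevel_le {Y₁ Y₂ : Type*} [MeasurableSpace Y₁]
    [MeasurableSpace Y₂] {μ : Measure Y₁} {ν : Measure Y₂} {h : Y₁ → ℝ} {u : Y₂ → ℝ}
    (hh : AEMeasurable h μ) (h0 : ∀ y, 0 ≤ h y) (hu : AEMeasurable u ν) (u0 : ∀ y, 0 ≤ u y)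
    {q r γ K L : ℝ} (hq : 1 < q) (hqr : q < r) (hγ : 0 < γ) (hK : 0 ≤ K) (hL : 0 ≤ L)
    (hdist : ∀ t : ℝ, 0 < t → ν {y | t < u y} ≤
      ENNReal.ofReal (K / t) * ∫⁻ y, ENNReal.ofReal (if γ * t < h y then h y else 0) ∂μ +
        ENNReal.ofReal ((L / t) ^ r) *
          ∫⁻ y, ENNReal.ofReal (if γ * t < h y then 0 else h y ^ r) ∂μ)
    (hfin : ∫⁻ y, ENNReal.ofReal (h y ^ q) ∂μ ≠ ∞) :
    ∫⁻ y, ENNReal.ofReal (u y ^ q) ∂ν ≤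
      ENNReal.ofReal (q * (K * γ ^ (1 - q) / (q - 1) + L ^ r * γ ^ (r - q) / (r - q))) *
        ∫⁻ y, ENNReal.ofReal (h y ^ q) ∂μ := by
  have hq1 := sub_pos.2 hq
  have hqr1 := sub_pos.2 hqr
  have hmeas : Measurable fun t : ℝ =>
      ∫⁻ y, ENNReal.ofReal (if γ * t < h y then h y else 0) ∂μ := by
    refine Antitone.measurable fun s t hst => lintegral_mono fun y => ENNReal.ofReal_le_ofReal ?_
    have := mul_le_mul_of_nonneg_left hst hγ.le
    have := h0 y
    split_ifs <;> linarith
  rw [lintegral_rpow_eq_lintegral_meas_lt_mul ν (Filter.Eventually.of_forall u0) hu (by linarith),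
    ENNReal.ofReal_mul (by linarith), mul_assoc]
  refine mul_le_mul_right ?_ _
  rw [ENNReal.ofReal_add (by positivity) (by positivity), add_mul,
    ← lintegral_large_part hh h0 hq hγ hK hfin, ← lintegral_small_part hh h0 hq hqr hγ hL hfin,
    ← lintegral_add_left (by fun_prop)]
  refine lintegral_mono_ae ?_
  filter_upwards [ae_restrict_mem measurableSet_Ioi] with t ht
  rw [← add_mul]
  exact mul_le_mul_left (hdist t ht) _

theorem eLpNorm_ofReal_eq_lintegral {Y E : Type*} [MeasurableSpace Y] [NormedAddCommGroup E]
    (f : Y → E) (μ : Measure Y) {p : ℝ} (hp : 0 < p) :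
    eLpNorm f (ENNReal.ofReal p) μ = (∫⁻ y, ENNReal.ofReal (‖f y‖ ^ p) ∂μ) ^ (1 / p) := by
  rw [eLpNorm_eq_lintegral_rpow_enorm_toReal (by simpa using hp) ENNReal.ofReal_ne_top,
    ENNReal.toReal_ofReal hp.le]
  simp only [← ofReal_norm, ENNReal.ofReal_rpow_of_nonneg (norm_nonneg _) hp.le]

theorem exists_mem_split {Y₁ Y₂ : Type*} [MeasurableSpace Y₁] [MeasurableSpace Y₂]
    {ν₁ : Measure Y₁} {ν₂ : Measure Y₂} {B₁ B₂ : Type*} [NormedAddCommGroup B₁] [NormedSpace ℝ B₁]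
    [NormedAddCommGroup B₂] {V : Set (Y₁ → B₁)}
    (hVmul : ∀ f ∈ V, ∀ g : Y₁ → ℝ, Measurable g → (∃ M : ℝ, ∀ y, |g y| ≤ M) →
      (fun y => g y • f y) ∈ V)
    {T : (Y₁ → B₁) → (Y₂ → B₂)}
    (hTadd : ∀ f ∈ V, ∀ g ∈ V, T (f + g) =ᵐ[ν₂] T f + T g)
    {f : Y₁ → B₁} (hf : f ∈ V) {h : Y₁ → ℝ} (hh : Measurable h) (hfh : ∀ᵐ y ∂ν₁, ‖f y‖ = h y)
    {g : ℝ → ℝ} (hg : Measurable g) (hgI : ∀ x, g x ∈ Icc (0 : ℝ) 1) :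
    ∃ f₀ ∈ V, ∃ f₁ ∈ V, (∀ᵐ y ∂ν₁, ‖f₀ y‖ = g (h y) * h y) ∧
      (∀ᵐ y ∂ν₁, ‖f₁ y‖ = (1 - g (h y)) * h y) ∧
      ∀ᵐ y ∂ν₂, ‖T f y‖ ≤ ‖T f₀ y‖ + ‖T f₁ y‖ := by
  have m0 : (fun y => g (h y) • f y) ∈ V := hVmul f hf _ (hg.comp hh)
    ⟨1, fun y => abs_le.2 ⟨by linarith [(hgI (h y)).1], (hgI (h y)).2⟩⟩
  have m1 : (fun y => (1 - g (h y)) • f y) ∈ V :=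
    hVmul f hf _ (measurable_const.sub (hg.comp hh))
      ⟨1, fun y => abs_le.2 ⟨by linarith [(hgI (h y)).2], by linarith [(hgI (h y)).1]⟩⟩
  refine ⟨_, m0, _, m1, ?_, ?_, ?_⟩
  · filter_upwards [hfh] with y hy
    rw [norm_smul, hy, Real.norm_of_nonneg (hgI _).1]
  · filter_upwards [hfh] with y hy
    rw [norm_smul, hy, Real.norm_of_nonneg (sub_nonneg.2 (hgI _).2)]
  · have hsum : (fun y => g (h y) • f y) + (fun y => (1 - g (h y)) • f y) = f := by
      funext y
      simp [← add_smul]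
    have := hTadd _ m0 _ m1
    rw [hsum] at this
    filter_upwards [this] with y hy
    rw [hy]
    exact norm_add_le _ _

theorem measure_superlevel_add_le {Y : Type*} [MeasurableSpace Y] {ν : Measure Y} {u v w : Y → ℝ}
    (huvw : ∀ᵐ y ∂ν, u y ≤ v y + w y) (t : ℝ) :
    ν {y | t < u y} ≤ ν {y | t / 2 < v y} + ν {y | t / 2 < w y} := by
  refine (measure_mono_ae ?_).trans (measure_union_le _ _)
  filter_upwards [huvw] with y hy ht
  have ht : t < u y := ht
  rcases le_or_gt (v y) (t / 2) with h | h
  · exact Or.inr (show t / 2 < w y by linarith)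
  · exact Or.inl h

theorem weakType_norm {Y₁ Y₂ : Type*} [MeasurableSpace Y₁] [MeasurableSpace Y₂]
    {ν₁ : Measure Y₁} {ν₂ : Measure Y₂} {B₁ B₂ : Type*} [NormedAddCommGroup B₁]
    [NormedAddCommGroup B₂] {f : Y₁ → B₁} {F : Y₂ → B₂} {A : ℝ}
    (hweak : ∀ lam : ℝ≥0∞, 0 < lam → ν₂ {y | lam < (‖F y‖₊ : ℝ≥0∞)} ≤
        ENNReal.ofReal A * (∫⁻ y, (‖f y‖₊ : ℝ≥0∞) ∂ν₁) / lam)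
    {t : ℝ} (ht : 0 < t) :
    ν₂ {y | t < ‖F y‖} ≤ ENNReal.ofReal (A / t) * ∫⁻ y, ENNReal.ofReal ‖f y‖ ∂ν₁ := by
  have h1 := hweak (ENNReal.ofReal t) (ENNReal.ofReal_pos.2 ht)
  have e1 : {y | ENNReal.ofReal t < (‖F y‖₊ : ℝ≥0∞)} = {y | t < ‖F y‖} := by
    ext y
    rw [mem_ofPred_eq, mem_ofPred_eq, ← enorm_eq_nnnorm, ← ofReal_norm,
      ENNReal.ofReal_lt_ofReal_iff_of_nonneg ht.le]
  have e2 : ∀ y, (‖f y‖₊ : ℝ≥0∞) = ENNReal.ofReal ‖f y‖ := fun y => by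
    rw [← enorm_eq_nnnorm, ← ofReal_norm]
  rw [e1] at h1
  simp only [e2] at h1
  refine h1.trans (le_of_eq ?_)
  rw [ENNReal.ofReal_div_of_pos ht, mul_comm, ENNReal.div_eq_inv_mul, ENNReal.div_eq_inv_mul]
  ring

theorem chebyshev_norm {Y : Type*} [MeasurableSpace Y] {ν : Measure Y} {E : Type*}
    [NormedAddCommGroup E] {F : Y → E} (hF : AEStronglyMeasurable F ν) {r t : ℝ} (hr : 0 < r)
    (ht : 0 < t) :
    ν {y | t < ‖F y‖} ≤ ENNReal.ofReal ((1 / t) ^ r) * ∫⁻ y, ENNReal.ofReal (‖F y‖ ^ r) ∂ν := by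
  have h1 := meas_ge_le_lintegral_div (hF.norm.aemeasurable.pow_const r).ennreal_ofReal
    (ε := ENNReal.ofReal (t ^ r)) (by simpa using Real.rpow_pos_of_pos ht r) (by simp)
  refine (measure_mono fun y (hy : t < ‖F y‖) => ?_).trans (h1.trans (le_of_eq ?_))
  · exact ENNReal.ofReal_le_ofReal (Real.rpow_le_rpow ht.le hy.le hr.le)
  · rw [ENNReal.div_eq_inv_mul, ← ENNReal.ofReal_inv_of_pos (by positivity),
      Real.div_rpow zero_le_one ht.le, Real.one_rpow, one_div]

theorem exists_measurable_norm_ae_eq {Y E : Type*} [MeasurableSpace Y] [NormedAddCommGroup E]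
    {μ : Measure Y} {f : Y → E} (hf : AEStronglyMeasurable f μ) :
    ∃ h : Y → ℝ, Measurable h ∧ (∀ y, 0 ≤ h y) ∧ ∀ᵐ y ∂μ, ‖f y‖ = h y :=
  ⟨fun y => ‖hf.mk f y‖, hf.stronglyMeasurable_mk.norm.measurable, fun _ => norm_nonneg _,
    hf.ae_eq_mk.fun_comp norm⟩

section Operator

variable {Y₁ Y₂ : Type*} [MeasurableSpace Y₁] [MeasurableSpace Y₂]
  {ν₁ : Measure Y₁} {ν₂ : Measure Y₂} {B₁ B₂ : Type*} [NormedAddCommGroup B₁] [NormedSpace ℝ B₁]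
  [NormedAddCommGroup B₂] {V : Set (Y₁ → B₁)} {T : (Y₁ → B₁) → (Y₂ → B₂)}

theorem marcinkiewicz_lt_top
    (hVmeas : ∀ f ∈ V, AEStronglyMeasurable f ν₁)
    (hVmul : ∀ f ∈ V, ∀ g : Y₁ → ℝ, Measurable g → (∃ M : ℝ, ∀ y, |g y| ≤ M) →
      (fun y => g y • f y) ∈ V)
    (hTmeas : ∀ f ∈ V, AEStronglyMeasurable (T f) ν₂)
    (hTadd : ∀ f ∈ V, ∀ g ∈ V, T (f + g) =ᵐ[ν₂] T f + T g)
    {q r A B γ : ℝ} (hq : 1 < q) (hqr : q < r) (hA : 0 < A) (hB : 0 < B) (hγ : 0 < γ)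
    (hweak : ∀ f ∈ V, ∀ t : ℝ, 0 < t →
      ν₂ {y | t < ‖T f y‖} ≤ ENNReal.ofReal (A / t) * ∫⁻ y, ENNReal.ofReal ‖f y‖ ∂ν₁)
    (hstrong : ∀ f ∈ V, ∫⁻ y, ENNReal.ofReal (‖T f y‖ ^ r) ∂ν₂ ≤
      ENNReal.ofReal (B ^ r) * ∫⁻ y, ENNReal.ofReal (‖f y‖ ^ r) ∂ν₁)
    {f : Y₁ → B₁} (hf : f ∈ V) :
    ∫⁻ y, ENNReal.ofReal (‖T f y‖ ^ q) ∂ν₂ ≤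
      ENNReal.ofReal (q * (2 * A * γ ^ (1 - q) / (q - 1) + (2 * B) ^ r * γ ^ (r - q) / (r - q))) *
        ∫⁻ y, ENNReal.ofReal (‖f y‖ ^ q) ∂ν₁ := by
  have hq1 := sub_pos.2 hq
  have hqr1 := sub_pos.2 hqr
  rcases eq_or_ne (∫⁻ y, ENNReal.ofReal (‖f y‖ ^ q) ∂ν₁) ∞ with htop | hfin
  · rw [htop, ENNReal.mul_top (ENNReal.ofReal_pos.2 (by positivity)).ne']
    exact le_top
  obtain ⟨h, hh, h0, hfh⟩ := exists_measurable_norm_ae_eq (hVmeas f hf)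
  have e : ∫⁻ y, ENNReal.ofReal (‖f y‖ ^ q) ∂ν₁ = ∫⁻ y, ENNReal.ofReal (h y ^ q) ∂ν₁ :=
    lintegral_congr_ae (by filter_upwards [hfh] with y hy; rw [hy])
  rw [e] at hfin ⊢
  refine lintegral_rpow_le_of_measure_superlevel_le hh.aemeasurable h0
    (hTmeas f hf).norm.aemeasurable (fun _ => norm_nonneg _) hq hqr hγ (by positivity)
    (by positivity) (fun t ht => ?_) hfin
  obtain ⟨f₀, m₀, f₁, m₁, n₀, n₁, hle⟩ := exists_mem_split hVmul hTadd hf hh hfh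
    (g := fun x => if γ * t < x then 1 else 0)
    (Measurable.ite measurableSet_Ioi measurable_const measurable_const)
    (fun x => by split_ifs <;> simp)
  have ht2 : 0 < t / 2 := by positivity
  refine (measure_superlevel_add_le hle t).trans (add_le_add ?_ ?_)
  · refine (hweak f₀ m₀ _ ht2).trans (le_of_eq ?_)
    congr 1
    · congr 1
      field_simp
    · refine lintegral_congr_ae ?_
      filter_upwards [n₀] with y hy
      rw [hy]
      split_ifs <;> simp
  · refine (chebyshev_norm (hTmeas f₁ m₁) (r := r) (by linarith) ht2).trans ?_
    refine (mul_le_mul_right (hstrong f₁ m₁) _).trans (le_of_eq ?_)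
    rw [← mul_assoc, ← ENNReal.ofReal_mul (by positivity), ← Real.mul_rpow (by positivity) hB.le]
    congr 1
    · congr 2
      field_simp
    · refine lintegral_congr_ae ?_
      filter_upwards [n₁] with y hy
      rw [hy]
      split_ifs <;> simp [Real.zero_rpow (show r ≠ 0 by linarith)]

theorem marcinkiewicz_top
    (hVmeas : ∀ f ∈ V, AEStronglyMeasurable f ν₁)
    (hVmul : ∀ f ∈ V, ∀ g : Y₁ → ℝ, Measurable g → (∃ M : ℝ, ∀ y, |g y| ≤ M) →
      (fun y => g y • f y) ∈ V)
    (hTmeas : ∀ f ∈ V, AEStronglyMeasurable (T f) ν₂)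
    (hTadd : ∀ f ∈ V, ∀ g ∈ V, T (f + g) =ᵐ[ν₂] T f + T g)
    {q A B : ℝ} (hq : 1 < q) (hA : 0 < A) (hB : 0 < B)
    (hweak : ∀ f ∈ V, ∀ t : ℝ, 0 < t →
      ν₂ {y | t < ‖T f y‖} ≤ ENNReal.ofReal (A / t) * ∫⁻ y, ENNReal.ofReal ‖f y‖ ∂ν₁)
    (hstrong : ∀ f ∈ V, eLpNorm (T f) ∞ ν₂ ≤ ENNReal.ofReal B * eLpNorm f ∞ ν₁)
    {f : Y₁ → B₁} (hf : f ∈ V) :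
    ∫⁻ y, ENNReal.ofReal (‖T f y‖ ^ q) ∂ν₂ ≤
      ENNReal.ofReal (q * (2 * A * (1 / (2 * B)) ^ (1 - q) / (q - 1))) *
        ∫⁻ y, ENNReal.ofReal (‖f y‖ ^ q) ∂ν₁ := by
  have hq1 := sub_pos.2 hq
  rcases eq_or_ne (∫⁻ y, ENNReal.ofReal (‖f y‖ ^ q) ∂ν₁) ∞ with htop | hfin
  · rw [htop, ENNReal.mul_top (ENNReal.ofReal_pos.2 (by positivity)).ne']
    exact le_top
  obtain ⟨h, hh, h0, hfh⟩ := exists_measurable_norm_ae_eq (hVmeas f hf)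
  have e : ∫⁻ y, ENNReal.ofReal (‖f y‖ ^ q) ∂ν₁ = ∫⁻ y, ENNReal.ofReal (h y ^ q) ∂ν₁ :=
    lintegral_congr_ae (by filter_upwards [hfh] with y hy; rw [hy])
  rw [e] at hfin ⊢
  have key := lintegral_rpow_le_of_measure_superlevel_le hh.aemeasurable h0
    (hTmeas f hf).norm.aemeasurable (fun _ => norm_nonneg _) hq (lt_add_one q)
    (γ := 1 / (2 * B)) (K := 2 * A) (L := 0) (by positivity) (by positivity) le_rfl
    (fun t ht => ?_) hfin
  · simpa [Real.zero_rpow (show q + 1 ≠ 0 by linarith)] using key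
  obtain ⟨f₀, m₀, f₁, m₁, n₀, n₁, hle⟩ := exists_mem_split hVmul hTadd hf hh hfh
    (g := fun x => if 1 / (2 * B) * t < x then 1 else 0)
    (Measurable.ite measurableSet_Ioi measurable_const measurable_const)
    (fun x => by split_ifs <;> simp)
  have ht2 : 0 < t / 2 := by positivity
  refine (measure_superlevel_add_le hle t).trans (add_le_add ?_ ?_)
  · refine (hweak f₀ m₀ _ ht2).trans (le_of_eq ?_)
    congr 1
    · congr 1
      field_simp
    · refine lintegral_congr_ae ?_
      filter_upwards [n₀] with y hy
      rw [hy]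
      split_ifs <;> simp
  · have hf₁ : eLpNorm f₁ ∞ ν₁ ≤ ENNReal.ofReal (1 / (2 * B) * t) := by
      rw [eLpNorm_exponent_top]
      refine eLpNormEssSup_le_of_ae_bound ?_
      filter_upwards [n₁] with y hy
      rw [hy]
      split_ifs with hlt
      · simp only [sub_self, zero_mul]
        positivity
      · linarith [not_lt.1 hlt]
    have hTf₁ : eLpNormEssSup (T f₁) ν₂ ≤ ENNReal.ofReal (t / 2) := by
      rw [← eLpNorm_exponent_top]
      refine ((hstrong f₁ m₁).trans (mul_le_mul_right hf₁ _)).trans (le_of_eq ?_)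
      rw [← ENNReal.ofReal_mul hB.le]
      congr 1
      field_simp
    have hnull : ν₂ {y | t / 2 < ‖T f₁ y‖} = 0 := by
      refine measure_mono_null (fun y (hy : t / 2 < ‖T f₁ y‖) => ?_)
        (meas_eLpNormEssSup_lt (f := T f₁) (μ := ν₂))
      refine lt_of_le_of_lt hTf₁ ?_
      rwa [← ofReal_norm, ENNReal.ofReal_lt_ofReal_iff_of_nonneg ht2.le]
    rw [hnull]
    exact zero_le

theorem interpolate_strong_type
    (hVmeas : ∀ f ∈ V, AEStronglyMeasurable f ν₁)
    (hVmul : ∀ f ∈ V, ∀ g : Y₁ → ℝ, Measurable g → (∃ M : ℝ, ∀ y, |g y| ≤ M) →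
      (fun y => g y • f y) ∈ V)
    (hTmeas : ∀ f ∈ V, AEStronglyMeasurable (T f) ν₂)
    (hTadd : ∀ f ∈ V, ∀ g ∈ V, T (f + g) =ᵐ[ν₂] T f + T g)
    {q p r c k : ℝ} (hq : 0 < q) (hqp : q < p) (hpr : p < r) (hc : 0 < c) (hk : 0 < k)
    (hTq : ∀ f ∈ V, ∫⁻ y, ENNReal.ofReal (‖T f y‖ ^ q) ∂ν₂ ≤
      ENNReal.ofReal (c * k ^ (-q)) * ∫⁻ y, ENNReal.ofReal (‖f y‖ ^ q) ∂ν₁)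
    (hTr : ∀ f ∈ V, ∫⁻ y, ENNReal.ofReal (‖T f y‖ ^ r) ∂ν₂ ≤
      ENNReal.ofReal (c * k ^ (-r)) * ∫⁻ y, ENNReal.ofReal (‖f y‖ ^ r) ∂ν₁)
    {f : Y₁ → B₁} (hf : f ∈ V) :
    ∫⁻ y, ENNReal.ofReal (‖T f y‖ ^ p) ∂ν₂ ≤
      ENNReal.ofReal (c * k ^ (-p)) * ∫⁻ y, ENNReal.ofReal (‖f y‖ ^ p) ∂ν₁ := by
  rcases eq_or_ne (∫⁻ y, ENNReal.ofReal (‖f y‖ ^ p) ∂ν₁) ∞ with htop | hfin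
  · rw [htop, ENNReal.mul_top (ENNReal.ofReal_pos.2 (by positivity)).ne']
    exact le_top
  obtain ⟨h, hh, h0, hfh⟩ := exists_measurable_norm_ae_eq (hVmeas f hf)
  have e : ∫⁻ y, ENNReal.ofReal (‖f y‖ ^ p) ∂ν₁ = ∫⁻ y, ENNReal.ofReal (h y ^ p) ∂ν₁ :=
    lintegral_congr_ae (by filter_upwards [hfh] with y hy; rw [hy])
  rw [e] at hfin ⊢
  refine lintegral_rpow_interpolate hh.aemeasurable h0 (hTmeas f hf).norm.aemeasurable
    (fun _ => norm_nonneg _) hq hqp hpr hc hk (fun g hg hgI => ?_) hfin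
  obtain ⟨f₀, m₀, f₁, m₁, n₀, n₁, hle⟩ := exists_mem_split hVmul hTadd hf hh hfh hg hgI
  refine ⟨fun y => ‖T f₀ y‖, fun y => ‖T f₁ y‖, fun _ => norm_nonneg _, fun _ => norm_nonneg _,
    (hTmeas f₀ m₀).norm.aemeasurable, hle, (hTq f₀ m₀).trans (le_of_eq ?_),
    (hTr f₁ m₁).trans (le_of_eq ?_)⟩
  · congr 1
    refine lintegral_congr_ae ?_
    filter_upwards [n₀] with y hy
    rw [hy]
  · congr 1
    refine lintegral_congr_ae ?_
    filter_upwards [n₁] with y hy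
    rw [hy]

end Operator

theorem exists_interpolation_parameters {q p r A B : ℝ} (hq : 1 < q) (hqp : q < p) (hpr : p < r)
    (hA : 0 < A) (hB : 0 < B) :
    ∃ γ c k : ℝ, 0 < γ ∧ 0 < c ∧ 0 < k ∧
      q * (2 * A * γ ^ (1 - q) / (q - 1) + (2 * B) ^ r * γ ^ (r - q) / (r - q)) = c * k ^ (-q) ∧
      B ^ r = c * k ^ (-r) ∧
      (c * k ^ (-p)) ^ (1 / p) ≤
        2 * (q / (q - 1) + 1 / (r / q - 1)) ^ ((1 / p - 1 / r) / (1 - q / r)) *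
          A ^ (r / (r - 1) * (1 / p - 1 / r)) * B ^ (r / (r - 1) / (p / (p - 1))) := by
  have hq1 := sub_pos.2 hq
  have hqr := sub_pos.2 (hqp.trans hpr)
  have hr1 : 0 < r - 1 := by linarith
  have hp1 : 0 < p - 1 := by linarith
  have hp : 0 < p := by linarith
  have hr : 0 < r := by linarith
  have hq0 : 0 < q := by linarith
  have hrp := sub_pos.2 hpr
  set D := q / (q - 1) + q / (r - q) with hD
  have hDpos : 0 < D := by positivity
  have hDe : q / (q - 1) + 1 / (r / q - 1) = D := by
    rw [hD]
    congr 1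
    rw [show r / q - 1 = (r - q) / q by field_simp, one_div_div]
  obtain ⟨a, rfl⟩ : ∃ a, Real.exp a = A := ⟨_, Real.exp_log hA⟩
  obtain ⟨b, rfl⟩ : ∃ b, Real.exp b = B := ⟨_, Real.exp_log hB⟩
  obtain ⟨d, hd⟩ : ∃ d, Real.exp d = D := ⟨_, Real.exp_log hDpos⟩
  obtain ⟨l, hl⟩ : ∃ l, Real.exp l = 2 := ⟨_, Real.exp_log two_pos⟩
  have hl0 : 0 ≤ l := Real.exp_le_exp.1 (by rw [hl, Real.exp_zero]; norm_num)
  rw [hDe]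
  set g := (l + a - r * (l + b)) / (r - 1) with hg
  set m := l + a + (1 - q) * g + d with hm
  set κ := (m - r * b) / (r - q) with hκ
  refine ⟨Real.exp g, Real.exp (m + q * κ), Real.exp κ, Real.exp_pos _, Real.exp_pos _,
    Real.exp_pos _, ?_, ?_, ?_⟩
  · have e1 : 2 * Real.exp a * Real.exp g ^ (1 - q) = Real.exp (l + a + (1 - q) * g) := by
      rw [← hl, ← Real.exp_mul, ← Real.exp_add, ← Real.exp_add]
      congr 1; ring
    have e2 : (2 * Real.exp b) ^ r * Real.exp g ^ (r - q) = Real.exp (l + a + (1 - q) * g) := by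
      rw [← hl, ← Real.exp_add, ← Real.exp_mul, ← Real.exp_mul, ← Real.exp_add]
      congr 1
      have : g * (r - 1) = l + a - r * (l + b) := by rw [hg]; field_simp
      linear_combination this
    rw [e1, e2, ← Real.exp_mul, ← Real.exp_add, show m + q * κ + κ * -q = m by ring, hm,
      Real.exp_add _ d, hd, hD]
    ring
  · rw [← Real.exp_mul, ← Real.exp_mul, ← Real.exp_add]
    congr 1
    have : κ * (r - q) = m - r * b := by rw [hκ]; field_simp
    linear_combination this
  · have hrq : 1 - q / r ≠ 0 := by
      rw [show 1 - q / r = (r - q) / r by field_simp]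
      positivity
    rw [← hd, ← hl, ← Real.exp_mul, ← Real.exp_add, ← Real.exp_mul, ← Real.exp_mul,
      ← Real.exp_mul, ← Real.exp_mul, ← Real.exp_add, ← Real.exp_add, ← Real.exp_add,
      Real.exp_le_exp]
    have hcoef : q * (r - p) / ((r - q) * p) ≤ 1 := by
      rw [div_le_one (by positivity)]
      nlinarith
    have := mul_le_mul_of_nonneg_left hcoef hl0
    have e3 : (m + q * κ + κ * -p) * (1 / p) = l * (q * (r - p) / ((r - q) * p)) +
        d * ((1 / p - 1 / r) / (1 - q / r)) + a * (r / (r - 1) * (1 / p - 1 / r)) +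
        b * (r / (r - 1) / (p / (p - 1))) := by
      rw [show (1 / p - 1 / r) / (1 - q / r) = (r - p) / (p * (r - q)) by
        rw [show 1 - q / r = (r - q) / r by field_simp]; field_simp]
      rw [hκ, hm, hg]
      field_simp
      ring
    linarith

theorem le_ofReal_sInf_mul {S : Set ℝ} {L N : ℝ≥0∞} {K : ℝ} (hS : S.Nonempty)
    (hS1 : ∀ t ∈ S, 1 ≤ t) (hK : 0 < K) (hle : ∀ t ∈ S, L ≤ ENNReal.ofReal (t * K) * N) :
    L ≤ ENNReal.ofReal (sInf S * K) * N := by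
  obtain ⟨t₀, ht₀⟩ := hS
  have hinf : 0 < sInf S := zero_lt_one.trans_le (le_csInf ⟨t₀, ht₀⟩ hS1)
  rcases eq_or_ne N ∞ with rfl | hN
  · rw [ENNReal.mul_top (ENNReal.ofReal_pos.2 (by positivity)).ne']
    exact le_top
  have hL : L ≠ ∞ :=
    ((hle t₀ ht₀).trans_lt (ENNReal.mul_lt_top ENNReal.ofReal_lt_top hN.lt_top)).ne
  lift N to ℝ≥0 using hN
  lift L to ℝ≥0 using hL
  have hle' : ∀ t ∈ S, (L : ℝ) ≤ t * K * N := by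
    intro t ht
    have ht0 : 0 ≤ t * K := mul_nonneg (zero_le_one.trans (hS1 t ht)) hK.le
    have h1 := hle t ht
    rw [← ENNReal.ofReal_coe_nnreal, ← ENNReal.ofReal_coe_nnreal (p := N),
      ← ENNReal.ofReal_mul ht0] at h1
    exact (ENNReal.ofReal_le_ofReal_iff (by positivity)).1 h1
  rw [← ENNReal.ofReal_coe_nnreal, ← ENNReal.ofReal_coe_nnreal (p := N),
    ← ENNReal.ofReal_mul (by positivity)]
  refine ENNReal.ofReal_le_ofReal ?_
  rcases (NNReal.coe_nonneg N).eq_or_lt with h0 | h0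
  · have := hle' t₀ ht₀
    rw [← h0, mul_zero] at this ⊢
    exact this
  · rw [mul_assoc, ← div_le_iff₀ (by positivity)]
    refine le_csInf ⟨t₀, ht₀⟩ fun t ht => ?_
    rw [div_le_iff₀ (by positivity), ← mul_assoc]
    exact hle' t ht

theorem eLpNorm_le_of_lintegral_le {Y₁ Y₂ E₁ E₂ : Type*} [MeasurableSpace Y₁] [MeasurableSpace Y₂]
    [NormedAddCommGroup E₁] [NormedAddCommGroup E₂] {μ : Measure Y₁} {ν : Measure Y₂}
    {f : Y₁ → E₁} {F : Y₂ → E₂} {p M M' : ℝ} (hp : 0 < p) (hM : 0 ≤ M) (hM' : M ^ (1 / p) ≤ M')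
    (h : ∫⁻ y, ENNReal.ofReal (‖F y‖ ^ p) ∂ν ≤
      ENNReal.ofReal M * ∫⁻ y, ENNReal.ofReal (‖f y‖ ^ p) ∂μ) :
    eLpNorm F (ENNReal.ofReal p) ν ≤ ENNReal.ofReal M' * eLpNorm f (ENNReal.ofReal p) μ := by
  have hp' : 0 ≤ 1 / p := by positivity
  rw [eLpNorm_ofReal_eq_lintegral F ν hp, eLpNorm_ofReal_eq_lintegral f μ hp]
  refine (ENNReal.rpow_le_rpow h hp').trans ?_
  rw [ENNReal.mul_rpow_of_nonneg _ _ hp', ENNReal.ofReal_rpow_of_nonneg hM hp']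
  exact mul_le_mul_left (ENNReal.ofReal_le_ofReal hM') _

theorem lintegral_le_of_eLpNorm_le {Y₁ Y₂ E₁ E₂ : Type*} [MeasurableSpace Y₁] [MeasurableSpace Y₂]
    [NormedAddCommGroup E₁] [NormedAddCommGroup E₂] {μ : Measure Y₁} {ν : Measure Y₂}
    {f : Y₁ → E₁} {F : Y₂ → E₂} {p B : ℝ} (hp : 0 < p) (hB : 0 ≤ B)
    (h : eLpNorm F (ENNReal.ofReal p) ν ≤ ENNReal.ofReal B * eLpNorm f (ENNReal.ofReal p) μ) :
    ∫⁻ y, ENNReal.ofReal (‖F y‖ ^ p) ∂ν ≤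
      ENNReal.ofReal (B ^ p) * ∫⁻ y, ENNReal.ofReal (‖f y‖ ^ p) ∂μ := by
  rw [eLpNorm_ofReal_eq_lintegral F ν hp, eLpNorm_ofReal_eq_lintegral f μ hp] at h
  have := ENNReal.rpow_le_rpow h hp.le
  rwa [ENNReal.mul_rpow_of_nonneg _ _ hp.le, ENNReal.ofReal_rpow_of_nonneg hB hp.le,
    ← ENNReal.rpow_mul, ← ENNReal.rpow_mul, one_div_mul_cancel hp.ne', ENNReal.rpow_one,
    ENNReal.rpow_one] at this

theorem one_le_of_mem_phiF_image {r p t : ℝ} (hpr : p ≤ r)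
    (ht : t ∈ (fun q : ℝ =>
      (q / (q - 1) + 1 / (r / q - 1)) ^ ((1 / p - 1 / r) / (1 - q / r))) '' Set.Ioo 1 p) :
    1 ≤ t := by
  obtain ⟨q, ⟨hq1, hqp⟩, rfl⟩ := ht
  have hq : 0 < q - 1 := sub_pos.2 hq1
  have hr : 0 < r := by linarith
  have h1 : 1 ≤ q / (q - 1) := by rw [one_le_div hq]; linarith
  have h2 : 0 < r / q - 1 := by rw [sub_pos, one_lt_div (by linarith)]; linarith
  have h3 : 0 < 1 - q / r := by rw [sub_pos, div_lt_one hr]; linarith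
  have h4 : 0 ≤ 1 / p - 1 / r := sub_nonneg.2 (one_div_le_one_div_of_le (by linarith) hpr)
  exact Real.one_le_rpow (by have := one_div_pos.2 h2; linarith) (by positivity)

theorem one_le_phiF {r p : ℝ} (hp : 1 < p) (hpr : p ≤ r) : 1 ≤ phiF r p :=
  le_csInf ((nonempty_Ioo.2 hp).image _) fun _ => one_le_of_mem_phiF_image hpr

theorem rpow_conj_le_phiTop {p : ℝ} (hp : 1 < p) : (p / (p - 1)) ^ (1 / p) ≤ phiTop p := by
  refine le_csInf ((nonempty_Ioo.2 hp).image _) ?_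
  rintro _ ⟨q, ⟨hq1, hqp⟩, rfl⟩
  have hq : 0 < q - 1 := sub_pos.2 hq1
  have hp1 : 0 < p - 1 := sub_pos.2 hp
  refine Real.rpow_le_rpow (by positivity) ?_ (by positivity)
  rw [div_le_div_iff₀ hp1 hq]
  linarith

theorem top_constant_eq {p A B : ℝ} (hp : 1 < p) (hA : 0 < A) (hB : 0 < B) :
    (p * (2 * A * (1 / (2 * B)) ^ (1 - p) / (p - 1))) ^ (1 / p) =
      2 * (p / (p - 1)) ^ (1 / p) * A ^ (1 / p) * B ^ (1 / (p / (p - 1))) := by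
  have hp1 : 0 < p - 1 := sub_pos.2 hp
  have hp0 : 0 < p := by linarith
  have e : p * (2 * A * (1 / (2 * B)) ^ (1 - p) / (p - 1)) =
      2 ^ p * (p / (p - 1)) * A * B ^ (p - 1) := by
    rw [one_div, Real.inv_rpow (by positivity), ← Real.rpow_neg (by positivity), neg_sub,
      Real.mul_rpow (by positivity) hB.le, Real.rpow_sub_one (two_ne_zero' ℝ)]
    field_simp
  rw [e, Real.mul_rpow (by positivity) (by positivity), Real.mul_rpow (by positivity) hA.le,
    Real.mul_rpow (by positivity) (by positivity), ← Real.rpow_mul (by positivity),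
    ← Real.rpow_mul hB.le, mul_one_div_cancel hp0.ne', Real.rpow_one]
  congr 2
  field_simp

/-- quantitative Marcinkiewicz interpolation from a weak `(1,1)` bound
and a strong `(r,r)` bound, `r ∈ (1,∞]`, with constant `2 φ(r,p) A^{r'(1/p−1/r)} B^{r'/p'}`. -/
theorem stmt_10 {Y₁ Y₂ : Type*} [MeasurableSpace Y₁] [MeasurableSpace Y₂]
    (ν₁ : Measure Y₁) (ν₂ : Measure Y₂)
    {B₁ B₂ : Type*} [NormedAddCommGroup B₁] [NormedSpace ℝ B₁]
    [NormedAddCommGroup B₂] [NormedSpace ℝ B₂]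
    (V : Set (Y₁ → B₁))
    (hVmeas : ∀ f ∈ V, AEStronglyMeasurable f ν₁)
    (hVadd : ∀ f ∈ V, ∀ g ∈ V, f + g ∈ V)
    (hVsmul : ∀ (c : ℝ), ∀ f ∈ V, c • f ∈ V)
    (hVmul : ∀ f ∈ V, ∀ g : Y₁ → ℝ, Measurable g → (∃ M : ℝ, ∀ y, |g y| ≤ M) →
      (fun y => g y • f y) ∈ V)
    (T : (Y₁ → B₁) → (Y₂ → B₂))
    (hTmeas : ∀ f ∈ V, AEStronglyMeasurable (T f) ν₂)
    (hTadd : ∀ f ∈ V, ∀ g ∈ V, T (f + g) =ᵐ[ν₂] T f + T g)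
    (hTsmul : ∀ (c : ℝ), ∀ f ∈ V, T (c • f) =ᵐ[ν₂] c • T f)
    (r : ℝ≥0∞) (hr : 1 < r) (A Bc : ℝ) (hA : 0 < A) (hB : 0 < Bc)
    (hweak : ∀ f ∈ V, ∀ lam : ℝ≥0∞, 0 < lam →
      ν₂ {y | lam < (‖T f y‖₊ : ℝ≥0∞)} ≤
        ENNReal.ofReal A * (∫⁻ y, (‖f y‖₊ : ℝ≥0∞) ∂ν₁) / lam)
    (hstrong : ∀ f ∈ V, eLpNorm (T f) r ν₂ ≤ ENNReal.ofReal Bc * eLpNorm f r ν₁) :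
    ∀ p : ℝ, 1 < p → ENNReal.ofReal p ≤ r → ∀ f ∈ V,
      eLpNorm (T f) (ENNReal.ofReal p) ν₂ ≤
        ENNReal.ofReal (2 * phiE r p * A ^ (conjR r * (1 / p - (r⁻¹).toReal)) *
            Bc ^ (conjR r / (p / (p - 1)))) *
          eLpNorm f (ENNReal.ofReal p) ν₁ := by
  intro p hp hpr f hf
  have hp0 : 0 < p := by linarith
  have hweak' : ∀ f ∈ V, ∀ t : ℝ, 0 < t →
      ν₂ {y | t < ‖T f y‖} ≤ ENNReal.ofReal (A / t) * ∫⁻ y, ENNReal.ofReal ‖f y‖ ∂ν₁ :=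
    fun f hf t ht => weakType_norm (hweak f hf) ht
  rcases eq_or_ne r ∞ with rfl | hrt
  · have hmain := marcinkiewicz_top hVmeas hVmul hTmeas hTadd hp hA hB hweak' hstrong hf
    have hp1 := sub_pos.2 hp
    refine eLpNorm_le_of_lintegral_le hp0 (by positivity) ?_ hmain
    rw [top_constant_eq hp hA hB]
    simp only [phiE, conjR, if_true, ENNReal.inv_top, ENNReal.toReal_zero, sub_zero, one_mul]
    have := rpow_conj_le_phiTop hp
    gcongr
  lift r to ℝ≥0 using hrt
  obtain ⟨R, hR⟩ : ∃ R : ℝ, R = r := ⟨_, rfl⟩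
  have hrR : (r : ℝ≥0∞) = ENNReal.ofReal R := by rw [hR, ENNReal.ofReal_coe_nnreal]
  have hR1 : 1 < R := by rw [hR]; exact_mod_cast hr
  have hpR : p ≤ R := by
    rw [hrR, ENNReal.ofReal_le_ofReal_iff (by linarith)] at hpr
    exact hpr
  have hφ := one_le_phiF hp hpR
  have e1 : phiE r p = phiF R p := by simp [phiE, hR]
  have e2 : conjR r = R / (R - 1) := by simp [conjR, hR]
  have e3 : ((r : ℝ≥0∞)⁻¹).toReal = 1 / R := by simp [hR]
  rw [e1, e2, e3]
  rw [hrR] at hstrong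
  rcases hpR.eq_or_lt with rfl | hlt
  · refine (hstrong f hf).trans (mul_le_mul_left (ENNReal.ofReal_le_ofReal ?_) _)
    have hp1 := sub_pos.2 hp
    rw [sub_self, mul_zero, Real.rpow_zero, div_self (by positivity), Real.rpow_one, mul_one]
    nlinarith
  have hstrong' := fun f hf => lintegral_le_of_eLpNorm_le (by linarith) hB.le (hstrong f hf)
  rw [show 2 * phiF R p * A ^ (R / (R - 1) * (1 / p - 1 / R)) *
      Bc ^ (R / (R - 1) / (p / (p - 1))) = phiF R p * (2 * A ^ (R / (R - 1) * (1 / p - 1 / R)) *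
      Bc ^ (R / (R - 1) / (p / (p - 1)))) by ring]
  refine le_ofReal_sInf_mul ((nonempty_Ioo.2 hp).image _)
    (fun _ => one_le_of_mem_phiF_image hpR) (by positivity) ?_
  rintro _ ⟨q, ⟨hq1, hqp⟩, rfl⟩
  obtain ⟨γ, c, k, hγ, hc, hk, hq', hr', hle⟩ :=
    exists_interpolation_parameters hq1 hqp hlt hA hB
  have hTq := fun f hf => marcinkiewicz_lt_top hVmeas hVmul hTmeas hTadd hq1 (hqp.trans hlt) hA hB
    hγ hweak' hstrong' (f := f) hf
  rw [hq'] at hTq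
  rw [hr'] at hstrong'
  refine eLpNorm_le_of_lintegral_le hp0 (by positivity) (hle.trans (le_of_eq (by ring)))
    (interpolate_strong_type hVmeas hVmul hTmeas hTadd (by linarith) hqp hlt hc hk hTq hstrong' hf)
end

section
/- (Existence of local smoothing kernels) Let R > 0 with D_{4R} < ∞ and set V_r(x) := μ(B(x,r)). Then there exist a family (S_r)_{r∈(0,R]} of positive continuous functions on X × X and a constant C > 1 such that for all r ∈ (0,R]: (1) S_r(x,y) = 0 if d(x,y) ≥ 3r; (2) S_r(x,y) = S_r(y,x); (3) ∫_X S_r(x,y) dμ(y) = 1 for every x; (4) S_r(x,y) ≥ 1/( D_{4R}^5 min(V_r(x), V_r(y)) ) whenever d(x,y) < r/2; (5) S_r(x,y) ≤ 2 D_{4R}^2 / ( V_r(x) + V_r(y) ) for all x,y; (6) |S_r(x,y) − S_r(x',y)| ≤ C D_{4R}^8 d(x,x') / ( r ( min(V_r(x),V_r(x')) + V_r(y) ) ) for all x, x', y. -/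
open MeasureTheory Metric Set ENNReal NNReal

namespace LocalSmoothing

variable {X : Type*} [MetricSpace X]

/-- The tent function around `x`, equal to `1` on `B(x,r)` and to `0` off `B(x,3r/2)`. -/
noncomputable def tent (r : ℝ) (x y : X) : ℝ := max 0 (min 1 (3 - 2 * dist x y / r))

lemma tent_nonneg (r : ℝ) (x y : X) : 0 ≤ tent r x y := le_max_left _ _

lemma tent_le_one (r : ℝ) (x y : X) : tent r x y ≤ 1 :=
  max_le zero_le_one (min_le_left _ _)

lemma tent_comm (r : ℝ) (x y : X) : tent r x y = tent r y x := by
  simp only [tent, dist_comm]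

lemma tent_eq_one {r : ℝ} (hr : 0 < r) {x y : X} (h : dist x y ≤ r) : tent r x y = 1 := by
  have : dist x y / r ≤ 1 := (div_le_one hr).2 h
  have h1 : 1 ≤ 3 - 2 * dist x y / r := by rw [mul_div_assoc]; linarith
  simp [tent, min_eq_left h1]

lemma tent_eq_zero {r : ℝ} (hr : 0 < r) {x y : X} (h : 3 * r / 2 ≤ dist x y) :
    tent r x y = 0 := by
  have : 3 / 2 ≤ dist x y / r := by rw [le_div_iff₀ hr]; linarith
  refine max_eq_left ((min_le_right _ _).trans ?_)
  rw [mul_div_assoc]; linarith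

lemma abs_tent_sub_le {r : ℝ} (hr : 0 < r) (x x' y : X) :
    |tent r x y - tent r x' y| ≤ 2 * dist x x' / r := by
  have h : |(3 - 2 * dist x y / r) - (3 - 2 * dist x' y / r)| ≤ 2 * dist x x' / r := by
    have : (3 - 2 * dist x y / r) - (3 - 2 * dist x' y / r)
        = 2 * (dist x' y - dist x y) / r := by ring
    rw [this, abs_div, abs_mul, abs_of_pos hr, abs_two, dist_comm x x']
    gcongr
    exact abs_dist_sub_le _ _ _
  refine le_trans ?_ h
  refine (abs_max_sub_max_le_max _ _ _ _).trans (max_le (by simp) ?_)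
  exact (abs_min_sub_min_le_max _ _ _ _).trans (max_le (by simp) le_rfl)

lemma continuous_tent (r : ℝ) : Continuous fun z : X × X => tent r z.1 z.2 := by
  unfold tent; fun_prop

lemma continuous_tent_right (r : ℝ) (x : X) : Continuous fun z => tent r x z := by
  unfold tent; fun_prop

lemma continuous_tent_left (r : ℝ) (x : X) : Continuous fun z => tent r z x := by
  unfold tent; fun_prop

variable [MeasurableSpace X]

/-- `D` is a doubling constant of `μ` for radii at most `2r`, and the balls of radius `4r` have
positive finite measure. -/
structure IsDoublingAt (μ : Measure X) (r D : ℝ) : Prop where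
  pos : 0 < r
  one_le : 1 ≤ D
  measure_ne_top : ∀ x, μ (ball x (4 * r)) ≠ ∞
  measure_pos : ∀ (x : X) (s : ℝ), 0 < s → 0 < μ (ball x s)
  doubling : ∀ (x : X), ∀ s ∈ Ioc 0 (2 * r), μ.real (ball x (2 * s)) ≤ D * μ.real (ball x s)

/-- The averaging operator with tent kernel. -/
noncomputable def average (μ : Measure X) (r : ℝ) (g : X → ℝ) (x : X) : ℝ :=
  ∫ z, tent r x z * g z ∂μ

/-- The total mass of the tent function at `x`. -/
noncomputable def mass (μ : Measure X) (r : ℝ) (x : X) : ℝ := average μ r (fun _ => 1) x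

/-- The weight that makes `kernel` stochastic. -/
noncomputable def weight (μ : Measure X) (r : ℝ) (z : X) : ℝ :=
  (average μ r (fun y => (mass μ r y)⁻¹) z)⁻¹

/-- The smoothing kernel before normalization by the masses. -/
noncomputable def preKernel (μ : Measure X) (r : ℝ) (x y : X) : ℝ :=
  average μ r (fun z => weight μ r z * tent r z y) x

/-- The smoothing kernel at scale `r`. -/
noncomputable def kernel (μ : Measure X) (r : ℝ) (x y : X) : ℝ :=
  preKernel μ r x y / (mass μ r x * mass μ r y)

lemma preKernel_comm (μ : Measure X) (r : ℝ) (x y : X) :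
    preKernel μ r x y = preKernel μ r y x := by
  unfold preKernel average
  refine integral_congr_ae (.of_forall fun z => ?_)
  simp only [tent_comm r z]
  ring

lemma kernel_comm (μ : Measure X) (r : ℝ) (x y : X) : kernel μ r x y = kernel μ r y x := by
  rw [kernel, kernel, preKernel_comm, mul_comm (mass μ r x)]

namespace IsDoublingAt

variable {μ : Measure X} {r D : ℝ} (h : IsDoublingAt μ r D)
include h

lemma ne_top {x : X} {s : ℝ} (hs : s ≤ 4 * r) : μ (ball x s) ≠ ∞ :=
  measure_ne_top_of_subset (ball_subset_ball hs) (h.measure_ne_top x)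

lemma real_pos {x : X} {s : ℝ} (hs : 0 < s) (hs' : s ≤ 4 * r) : 0 < μ.real (ball x s) :=
  toReal_pos (h.measure_pos x s hs).ne' (h.ne_top hs')

lemma real_mono {x y : X} {s t : ℝ} (hst : s + dist x y ≤ t) (ht : t ≤ 4 * r) :
    μ.real (ball x s) ≤ μ.real (ball y t) :=
  measureReal_mono (ball_subset_ball' hst) (h.ne_top ht)

lemma four_mul_le (x : X) : μ.real (ball x (4 * r)) ≤ D ^ 2 * μ.real (ball x r) := by
  have hr := h.pos
  have h1 := h.doubling x r ⟨hr, by linarith⟩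
  have h2 := h.doubling x (2 * r) ⟨by linarith, le_rfl⟩
  have hD : 0 ≤ D := zero_le_one.trans h.one_le
  calc μ.real (ball x (4 * r)) = μ.real (ball x (2 * (2 * r))) := by ring_nf
    _ ≤ D * μ.real (ball x (2 * r)) := h2
    _ ≤ D * (D * μ.real (ball x r)) := by gcongr
    _ = _ := by ring

lemma two_mul_le (x : X) : μ.real (ball x (2 * r)) ≤ D ^ 2 * μ.real (ball x (r / 2)) := by
  have hr := h.pos
  have h1 := h.doubling x r ⟨hr, by linarith⟩
  have h2 := h.doubling x (r / 2) ⟨by linarith, by linarith⟩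
  rw [mul_div_cancel₀ r (two_ne_zero)] at h2
  have hD : 0 ≤ D := zero_le_one.trans h.one_le
  calc μ.real (ball x (2 * r)) ≤ D * μ.real (ball x r) := h1
    _ ≤ D * (D * μ.real (ball x (r / 2))) := by gcongr
    _ = _ := by ring

lemma tent_eq_zero_of_notMem {x z : X} {s : ℝ} (hs : 3 * r / 2 ≤ s) (hz : z ∉ ball x s) :
    tent r x z = 0 := by
  rw [mem_ball, dist_comm, not_lt] at hz
  exact tent_eq_zero h.pos (by linarith)

lemma kernel_eq_zero {x y : X} (hxy : 3 * r ≤ dist x y) : kernel μ r x y = 0 := by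
  have : preKernel μ r x y = 0 := by
    unfold preKernel average
    refine integral_eq_zero_of_ae (.of_forall fun z => ?_)
    by_cases hz : 3 * r / 2 ≤ dist x z
    · simp [tent_eq_zero h.pos hz]
    · have : 3 * r / 2 ≤ dist z y := by linarith [dist_triangle x z y]
      simp [tent_eq_zero h.pos this]
  rw [kernel, this, zero_div]

variable [BorelSpace X]

lemma integrable_of_support {f : X → ℝ} {x : X} {M : ℝ} (hf : Continuous f)
    (h0 : ∀ z ∉ ball x (4 * r), f z = 0) (hM : ∀ z ∈ ball x (4 * r), |f z| ≤ M) :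
    Integrable f μ := by
  rw [← integrableOn_iff_integrable_of_support_subset (s := ball x (4 * r))
    (fun z hz => by by_contra hz'; exact hz (h0 z hz'))]
  exact Measure.integrableOn_of_bounded (h.measure_ne_top x) hf.aestronglyMeasurable
    ((ae_restrict_iff' measurableSet_ball).2 (.of_forall hM))

lemma integrable_tent_mul {g : X → ℝ} {x : X} {M : ℝ} (hg : Continuous g)
    (hM : ∀ z ∈ ball x (3 * r / 2), |g z| ≤ M) : Integrable (fun z => tent r x z * g z) μ := by
  have hr := h.pos
  have hM0 : 0 ≤ M := (abs_nonneg _).trans (hM x (mem_ball_self (by positivity)))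
  refine h.integrable_of_support (x := x) (M := M) ((continuous_tent_right r x).mul hg)
    (fun z hz => ?_) (fun z _ => ?_)
  · rw [h.tent_eq_zero_of_notMem (by linarith) hz, zero_mul]
  · by_cases hz : z ∈ ball x (3 * r / 2)
    · rw [abs_mul, abs_of_nonneg (tent_nonneg _ _ _)]
      exact (mul_le_of_le_one_left (abs_nonneg _) (tent_le_one _ _ _)).trans (hM z hz)
    · rw [h.tent_eq_zero_of_notMem le_rfl hz]
      simpa using hM0

lemma average_le {g : X → ℝ} {x : X} {M : ℝ} (hg : Continuous g)
    (h0 : ∀ z ∈ ball x (3 * r / 2), 0 ≤ g z) (hM : ∀ z ∈ ball x (3 * r / 2), g z ≤ M) :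
    average μ r g x ≤ M * mass μ r x := by
  unfold mass average
  rw [← integral_const_mul]
  refine integral_mono (h.integrable_tent_mul (M := M) hg fun z hz => ?_)
    ((h.integrable_tent_mul (M := 1) continuous_const (by simp)).const_mul M) fun z => ?_
  · rw [abs_of_nonneg (h0 z hz)]; exact hM z hz
  · by_cases hz : z ∈ ball x (3 * r / 2)
    · have := mul_le_mul_of_nonneg_left (hM z hz) (tent_nonneg r x z)
      simp only; linarith
    · simp [h.tent_eq_zero_of_notMem le_rfl hz]

lemma mass_le (x : X) : mass μ r x ≤ μ.real (ball x (3 * r / 2)) := by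
  have hr := h.pos
  have hfin : μ (ball x (3 * r / 2)) ≠ ∞ := h.ne_top (by linarith)
  have : μ.real (ball x (3 * r / 2)) = ∫ z, (ball x (3 * r / 2)).indicator (fun _ => (1 : ℝ)) z ∂μ := by
    rw [integral_indicator measurableSet_ball]; simp
  rw [this]
  refine integral_mono (h.integrable_tent_mul (M := 1) continuous_const (by simp))
    ((integrable_indicator_iff measurableSet_ball).2 (integrableOn_const hfin)) fun z => ?_
  by_cases hz : z ∈ ball x (3 * r / 2)
  · simpa [hz] using tent_le_one r x z
  · simp [h.tent_eq_zero_of_notMem le_rfl hz, hz]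

lemma le_average {g : X → ℝ} {x : X} {m M s : ℝ} (hg : Continuous g) (hs : s ≤ r)
    (h0 : ∀ z ∈ ball x (3 * r / 2), 0 ≤ g z) (hM : ∀ z ∈ ball x (3 * r / 2), g z ≤ M)
    (hm : ∀ z ∈ ball x s, m ≤ g z) :
    m * μ.real (ball x s) ≤ average μ r g x := by
  have hr := h.pos
  have : m * μ.real (ball x s) = ∫ z, (ball x s).indicator (fun _ => m) z ∂μ := by
    rw [integral_indicator measurableSet_ball]; simp [mul_comm]
  rw [this]
  refine integral_mono ((integrable_indicator_iff measurableSet_ball).2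
    (integrableOn_const (h.ne_top (by linarith)))) (h.integrable_tent_mul (M := M) hg
      fun z hz => ?_) fun z => ?_
  · rw [abs_of_nonneg (h0 z hz)]; exact hM z hz
  · by_cases hz : z ∈ ball x s
    · have h1 : tent r x z = 1 := tent_eq_one hr (by
        rw [dist_comm]; exact (mem_ball.1 hz).le.trans hs)
      simpa [hz, h1] using hm z hz
    · simp only [hz, not_false_eq_true, indicator_of_notMem]
      by_cases hz' : z ∈ ball x (3 * r / 2)
      · exact mul_nonneg (tent_nonneg _ _ _) (h0 z hz')
      · simp [h.tent_eq_zero_of_notMem le_rfl hz']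

lemma abs_average_sub_le {g : X → ℝ} {x x' : X} {M : ℝ} (hg : Continuous g)
    (hM : ∀ z ∈ ball x (3 * r), |g z| ≤ M) (hx : dist x x' < r) :
    |average μ r g x - average μ r g x'| ≤ 2 * dist x x' / r * M * μ.real (ball x (3 * r)) := by
  have hr := h.pos
  have hsub : ball x' (3 * r / 2) ⊆ ball x (3 * r) :=
    ball_subset_ball' (by rw [dist_comm]; linarith)
  have i1 := h.integrable_tent_mul hg fun z hz =>
    hM z (ball_subset_ball (by linarith : 3 * r / 2 ≤ 3 * r) hz)
  have i2 := h.integrable_tent_mul hg fun z hz => hM z (hsub hz)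
  unfold average
  rw [← integral_sub i1 i2]
  have : 2 * dist x x' / r * M * μ.real (ball x (3 * r))
      = ∫ z, (ball x (3 * r)).indicator (fun _ => 2 * dist x x' / r * M) z ∂μ := by
    rw [integral_indicator measurableSet_ball]; simp [mul_comm]
  rw [this]
  refine (abs_integral_le_integral_abs).trans (integral_mono (i1.sub i2).abs
    ((integrable_indicator_iff measurableSet_ball).2
      (integrableOn_const (h.ne_top (by linarith)))) fun z => ?_)
  by_cases hz : z ∈ ball x (3 * r)
  · simp only [hz, indicator_of_mem]
    rw [← sub_mul, abs_mul]
    gcongr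
    · exact abs_tent_sub_le hr _ _ _
    · exact hM z hz
  · simp [hz, h.tent_eq_zero_of_notMem (by linarith) hz, h.tent_eq_zero_of_notMem le_rfl fun hz' => hz (hsub hz')]

lemma continuous_average {g : X → ℝ} (hg : Continuous g)
    (hM : ∀ x, ∃ M, ∀ z ∈ ball x (3 * r), |g z| ≤ M) : Continuous (average μ r g) := by
  have hr := h.pos
  rw [continuous_iff_continuousAt]
  intro x
  obtain ⟨M, hM⟩ := hM x
  rw [ContinuousAt, tendsto_iff_dist_tendsto_zero]
  refine squeeze_zero' (.of_forall fun _ => dist_nonneg)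
    (Filter.eventually_of_mem (ball_mem_nhds x hr) fun x' hx' => ?_)
    (g := fun x' => 2 * dist x x' / r * M * μ.real (ball x (3 * r))) ?_
  · rw [dist_comm, Real.dist_eq]
    exact h.abs_average_sub_le hg hM (by rwa [dist_comm])
  · have : Continuous fun x' => 2 * dist x x' / r * M * μ.real (ball x (3 * r)) := by fun_prop
    simpa using this.tendsto x

lemma real_le_mass (x : X) : μ.real (ball x r) ≤ mass μ r x := by
  have := h.le_average (g := fun _ => 1) (x := x) (m := 1) (M := 1) continuous_const le_rfl
    (by simp) (by simp) (by simp)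
  rwa [one_mul] at this

lemma mass_pos (x : X) : 0 < mass μ r x :=
  (h.real_pos h.pos (by linarith [h.pos])).trans_le (h.real_le_mass x)

lemma mass_le_mul (x : X) : mass μ r x ≤ D * μ.real (ball x r) := by
  have hr := h.pos
  exact (h.mass_le x).trans <| (h.real_mono (by rw [dist_self]; linarith) (by linarith)).trans
    (h.doubling x r ⟨hr, by linarith⟩)

lemma continuous_mass : Continuous (mass μ r) :=
  h.continuous_average continuous_const fun _ => ⟨1, by simp⟩

lemma continuous_inv_mass : Continuous fun y => (mass μ r y)⁻¹ :=
  h.continuous_mass.inv₀ fun y => (h.mass_pos y).ne'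

lemma inv_mass_le {x y : X} {s : ℝ} (hs : 0 < s) (hy : s + dist x y ≤ 4 * r) :
    (mass μ r y)⁻¹ ≤ D ^ 2 / μ.real (ball x s) := by
  have hV : 0 < μ.real (ball x s) := h.real_pos hs (by linarith [dist_nonneg (x := x) (y := y)])
  have h1 : μ.real (ball x s) ≤ D ^ 2 * mass μ r y :=
    (h.real_mono hy le_rfl).trans <| (h.four_mul_le y).trans <| by
      gcongr; exact h.real_le_mass y
  rw [inv_eq_one_div, div_le_div_iff₀ (h.mass_pos y) hV]
  linarith

lemma inv_mass_le_of_mem {x y : X} (hy : y ∈ ball x (3 * r)) :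
    (mass μ r y)⁻¹ ≤ D ^ 2 / μ.real (ball x r) :=
  h.inv_mass_le h.pos (by rw [mem_ball, dist_comm] at hy; linarith)

lemma average_inv_mass_le (z : X) : average μ r (fun y => (mass μ r y)⁻¹) z ≤ D ^ 2 := by
  have hr := h.pos
  have hV : 0 < μ.real (ball z (3 * r / 2)) := h.real_pos (by linarith) (by linarith)
  calc average μ r (fun y => (mass μ r y)⁻¹) z
      ≤ D ^ 2 / μ.real (ball z (3 * r / 2)) * mass μ r z :=
        h.average_le h.continuous_inv_mass (fun y _ => (inv_pos.2 (h.mass_pos y)).le)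
          fun y hy => h.inv_mass_le (by linarith) (by rw [mem_ball, dist_comm] at hy; linarith)
    _ ≤ D ^ 2 / μ.real (ball z (3 * r / 2)) * μ.real (ball z (3 * r / 2)) := by
        gcongr; exact h.mass_le z
    _ = D ^ 2 := by field_simp

lemma one_le_mul_average_inv_mass (z : X) :
    1 ≤ D ^ 2 * average μ r (fun y => (mass μ r y)⁻¹) z := by
  have hr := h.pos
  have hD : 0 < D := zero_lt_one.trans_le h.one_le
  have hV : 0 < μ.real (ball z r) := h.real_pos hr (by linarith)
  have := h.le_average (x := z) (m := (D ^ 2 * μ.real (ball z r))⁻¹) (s := r)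
    h.continuous_inv_mass le_rfl (fun y _ => (inv_pos.2 (h.mass_pos y)).le)
    (fun y hy => h.inv_mass_le_of_mem (ball_subset_ball (by linarith) hy)) fun y hy => by
      refine inv_anti₀ (h.mass_pos y) ((h.mass_le y).trans ?_)
      refine (h.real_mono ?_ le_rfl).trans (h.four_mul_le z)
      rw [mem_ball] at hy; linarith
  calc 1 = D ^ 2 * ((D ^ 2 * μ.real (ball z r))⁻¹ * μ.real (ball z r)) := by field_simp
    _ ≤ _ := by gcongr

lemma average_inv_mass_pos (z : X) : 0 < average μ r (fun y => (mass μ r y)⁻¹) z :=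
  pos_of_mul_pos_right (zero_lt_one.trans_le (h.one_le_mul_average_inv_mass z)) (sq_nonneg D)

lemma weight_pos (z : X) : 0 < weight μ r z := inv_pos.2 (h.average_inv_mass_pos z)

lemma weight_le (z : X) : weight μ r z ≤ D ^ 2 := by
  rw [weight, inv_le_iff_one_le_mul₀ (h.average_inv_mass_pos z)]
  exact h.one_le_mul_average_inv_mass z

lemma le_weight (z : X) : (D ^ 2)⁻¹ ≤ weight μ r z :=
  inv_anti₀ (h.average_inv_mass_pos z) (h.average_inv_mass_le z)

lemma continuous_weight : Continuous (weight μ r) := by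
  refine Continuous.inv₀ (h.continuous_average h.continuous_inv_mass fun x =>
    ⟨D ^ 2 / μ.real (ball x r), fun y hy => ?_⟩) fun z => (h.average_inv_mass_pos z).ne'
  rw [abs_of_pos (inv_pos.2 (h.mass_pos y))]
  exact h.inv_mass_le_of_mem hy

lemma continuous_weight_mul_tent (y : X) : Continuous fun z => weight μ r z * tent r z y :=
  h.continuous_weight.mul (continuous_tent_left r y)

lemma weight_mul_tent_nonneg (z y : X) : 0 ≤ weight μ r z * tent r z y :=
  mul_nonneg (h.weight_pos z).le (tent_nonneg _ _ _)

lemma weight_mul_tent_le (z y : X) : weight μ r z * tent r z y ≤ D ^ 2 :=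
  (mul_le_of_le_one_right (h.weight_pos z).le (tent_le_one _ _ _)).trans (h.weight_le z)

lemma preKernel_nonneg (x y : X) : 0 ≤ preKernel μ r x y :=
  integral_nonneg fun z => mul_nonneg (tent_nonneg _ _ _) (h.weight_mul_tent_nonneg z y)

lemma kernel_nonneg (x y : X) : 0 ≤ kernel μ r x y :=
  div_nonneg (h.preKernel_nonneg x y) (mul_pos (h.mass_pos x) (h.mass_pos y)).le

lemma preKernel_le (x y : X) : preKernel μ r x y ≤ D ^ 2 * mass μ r x :=
  h.average_le (h.continuous_weight_mul_tent y) (fun z _ => h.weight_mul_tent_nonneg z y)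
    fun z _ => h.weight_mul_tent_le z y

lemma abs_preKernel_sub_le {x x' : X} (y : X) (hx : dist x x' < r) :
    |preKernel μ r x y - preKernel μ r x' y|
      ≤ 2 * dist x x' / r * D ^ 2 * μ.real (ball x (3 * r)) :=
  h.abs_average_sub_le (h.continuous_weight_mul_tent y) (fun z _ => by
    rw [abs_of_nonneg (h.weight_mul_tent_nonneg z y)]; exact h.weight_mul_tent_le z y) hx

lemma abs_preKernel_sub_le_mass (x x' y : X) :
    |preKernel μ r x y - preKernel μ r x' y| ≤ 2 * dist x x' / r * D ^ 2 * mass μ r y := by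
  have hr := h.pos
  have i (x : X) := h.integrable_tent_mul (x := x) (M := D ^ 2)
    (h.continuous_weight_mul_tent y) fun z _ => by
      rw [abs_of_nonneg (h.weight_mul_tent_nonneg z y)]; exact h.weight_mul_tent_le z y
  have j : Integrable (fun z => tent r y z * 1) μ :=
    h.integrable_tent_mul (M := 1) continuous_const (by simp)
  unfold preKernel mass average
  rw [← integral_sub (i x) (i x'), ← integral_const_mul]
  refine abs_integral_le_integral_abs.trans
    (integral_mono ((i x).sub (i x')).abs (j.const_mul _) fun z => ?_)
  simp only
  rw [← sub_mul, abs_mul, abs_of_nonneg (h.weight_mul_tent_nonneg z y), tent_comm r z y, mul_one,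
    mul_assoc (_ / r)]
  exact mul_le_mul (abs_tent_sub_le hr _ _ _)
    (mul_le_mul_of_nonneg_right (h.weight_le z) (tent_nonneg _ _ _))
    (mul_nonneg (h.weight_pos z).le (tent_nonneg _ _ _)) (by positivity)

lemma three_mul_le_mass (x : X) : μ.real (ball x (3 * r)) ≤ D ^ 2 * mass μ r x := by
  have hr := h.pos
  refine (h.real_mono (by rw [dist_self]; linarith) le_rfl).trans ((h.four_mul_le x).trans ?_)
  gcongr
  exact h.real_le_mass x

lemma abs_mass_sub_le {x x' : X} (hx : dist x x' < r) :
    |mass μ r x - mass μ r x'| ≤ 2 * dist x x' / r * D ^ 2 * mass μ r x := by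
  have hr := h.pos
  refine (h.abs_average_sub_le (M := 1) continuous_const (by simp) hx).trans ?_
  rw [mul_one, mul_assoc _ (D ^ 2)]
  gcongr
  exact h.three_mul_le_mass x

lemma kernel_le (x y : X) :
    kernel μ r x y ≤ 2 * D ^ 2 / (μ.real (ball x r) + μ.real (ball y r)) := by
  have hr := h.pos
  have hx := h.mass_pos x
  have hy := h.mass_pos y
  have hVx : 0 < μ.real (ball x r) := h.real_pos hr (by linarith)
  have hVy : 0 < μ.real (ball y r) := h.real_pos hr (by linarith)
  have h1 := h.preKernel_le x y
  have h2 := h.preKernel_le y x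
  rw [preKernel_comm] at h2
  calc kernel μ r x y ≤ 2 * D ^ 2 / (mass μ r x + mass μ r y) := by
        rw [kernel, div_le_div_iff₀ (by positivity) (by positivity)]
        nlinarith
    _ ≤ _ := by gcongr <;> exact h.real_le_mass _

lemma le_preKernel {x y : X} (hxy : dist x y < r / 2) :
    (D ^ 2)⁻¹ * μ.real (ball x (r / 2)) ≤ preKernel μ r x y := by
  have hr := h.pos
  refine h.le_average (M := D ^ 2) (h.continuous_weight_mul_tent y) (by linarith)
    (fun z _ => h.weight_mul_tent_nonneg z y) (fun z _ => h.weight_mul_tent_le z y) fun z hz => ?_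
  rw [mem_ball] at hz
  rw [tent_eq_one hr (by linarith [dist_triangle z x y]), mul_one]
  exact h.le_weight z

lemma le_kernel_left {x y : X} (hxy : dist x y < r / 2) :
    1 / (D ^ 5 * μ.real (ball y r)) ≤ kernel μ r x y := by
  have hr := h.pos
  have hD : 0 < D := zero_lt_one.trans_le h.one_le
  have hx := h.mass_pos x
  have hy := h.mass_pos y
  have h1 : mass μ r x ≤ D ^ 2 * μ.real (ball x (r / 2)) := (h.mass_le x).trans <|
    (h.real_mono (by rw [dist_self]; linarith) (by linarith)).trans (h.two_mul_le x)
  have h2 : mass μ r x ≤ D ^ 4 * preKernel μ r x y := by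
    refine h1.trans ?_
    have := h.le_preKernel hxy
    rw [inv_mul_le_iff₀ (by positivity)] at this
    calc _ ≤ D ^ 2 * (D ^ 2 * preKernel μ r x y) := by gcongr
      _ = _ := by ring
  have hV : 0 < μ.real (ball y r) := h.real_pos hr (by linarith)
  rw [kernel, div_le_div_iff₀ (by positivity) (by positivity), one_mul]
  calc mass μ r x * mass μ r y
      ≤ (D ^ 4 * preKernel μ r x y) * (D * μ.real (ball y r)) := by
        have := h.preKernel_nonneg x y
        gcongr; exact h.mass_le_mul y
    _ = _ := by ring

lemma le_kernel {x y : X} (hxy : dist x y < r / 2) :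
    1 / (D ^ 5 * min (μ.real (ball x r)) (μ.real (ball y r))) ≤ kernel μ r x y := by
  rcases min_choice (μ.real (ball x r)) (μ.real (ball y r)) with e | e <;> rw [e]
  · rw [kernel_comm]; exact h.le_kernel_left (by rwa [dist_comm])
  · exact h.le_kernel_left hxy

lemma abs_kernel_sub_le_of_dist_lt {x x' : X} (y : X) (hx : dist x x' < r) :
    |kernel μ r x y - kernel μ r x' y|
      ≤ 8 * D ^ 4 * dist x x' / (r * (mass μ r x' + mass μ r y)) := by
  have hr := h.pos
  have hD := h.one_le
  have ha := h.mass_pos x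
  have ha' := h.mass_pos x'
  have hb := h.mass_pos y
  have m1 := h.abs_mass_sub_le hx
  have m2 := h.abs_mass_sub_le (x := x') (x' := x) (by rwa [dist_comm])
  have p1 := h.preKernel_le x y
  have p2 := h.preKernel_le y x
  have q1 := h.abs_preKernel_sub_le_mass x x' y
  have q2 := h.abs_preKernel_sub_le (x := x') (x' := x) y (by rwa [dist_comm])
  have p0 := h.preKernel_nonneg x y
  rw [preKernel_comm] at p2
  rw [dist_comm x' x, abs_sub_comm] at m2 q2
  have v := h.three_mul_le_mass x'
  set q := 2 * dist x x' / r with hq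
  have hq0 : 0 ≤ q := by positivity
  have q2' : |preKernel μ r x y - preKernel μ r x' y| ≤ q * D ^ 2 * (D ^ 2 * mass μ r x') :=
    q2.trans (by gcongr)
  unfold kernel
  generalize preKernel μ r x' y = A' at *
  generalize preKernel μ r x y = A at *
  generalize mass μ r x = a at *
  generalize mass μ r x' = a' at *
  generalize mass μ r y = b at *
  set N := |A / (a * b) - A' / (a' * b)| with hN
  have split : N * (a * a' * b) ≤ |a - a'| * A + a * |A - A'| := by
    have e : (A / (a * b) - A' / (a' * b)) * (a * a' * b) = -((a - a') * A) + a * (A - A') := by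
      field_simp; ring
    rw [hN, ← abs_of_pos (show 0 < a * a' * b by positivity), ← abs_mul, e]
    refine (abs_add_le _ _).trans_eq ?_
    rw [abs_neg, abs_mul, abs_mul, abs_of_nonneg p0, abs_of_pos ha]
  have hEE : D ^ 2 ≤ D ^ 4 := pow_le_pow_right₀ hD (by norm_num)
  have b1 : N * a' ≤ 2 * q * D ^ 4 := by
    have : N * a' * (a * b) ≤ 2 * q * D ^ 4 * (a * b) := by
      calc N * a' * (a * b) = N * (a * a' * b) := by ring
        _ ≤ |a - a'| * A + a * |A - A'| := split
        _ ≤ (q * D ^ 2 * a) * (D ^ 2 * b) + a * (q * D ^ 4 * b) := by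
          gcongr
          exact q1.trans (by gcongr)
        _ = _ := by ring
    exact le_of_mul_le_mul_right this (by positivity)
  have b2 : N * b ≤ 2 * q * D ^ 4 := by
    have : N * b * (a * a') ≤ 2 * q * D ^ 4 * (a * a') := by
      calc N * b * (a * a') = N * (a * a' * b) := by ring
        _ ≤ |a - a'| * A + a * |A - A'| := split
        _ ≤ (q * D ^ 2 * a') * (D ^ 2 * a) + a * (q * D ^ 2 * (D ^ 2 * a')) := by gcongr
        _ = _ := by ring
    exact le_of_mul_le_mul_right this (by positivity)
  rw [le_div_iff₀ (by positivity)]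
  calc N * (r * (a' + b)) = r * (N * a' + N * b) := by ring
    _ ≤ r * (2 * q * D ^ 4 + 2 * q * D ^ 4) := by gcongr
    _ = _ := by rw [hq]; field_simp; ring

lemma abs_kernel_sub_le (x x' y : X) :
    |kernel μ r x y - kernel μ r x' y| ≤ 8 * D ^ 8 * dist x x' /
      (r * (min (μ.real (ball x r)) (μ.real (ball x' r)) + μ.real (ball y r))) := by
  have hr := h.pos
  have hD := h.one_le
  have hVx : 0 < μ.real (ball x r) := h.real_pos hr (by linarith)
  have hVx' : 0 < μ.real (ball x' r) := h.real_pos hr (by linarith)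
  have hVy : 0 < μ.real (ball y r) := h.real_pos hr (by linarith)
  have hmin : 0 < min (μ.real (ball x r)) (μ.real (ball x' r)) := lt_min hVx hVx'
  rcases lt_or_ge (dist x x') r with hx | hx
  · refine (h.abs_kernel_sub_le_of_dist_lt y hx).trans ?_
    gcongr
    · norm_num
    · exact (min_le_right _ _).trans (h.real_le_mass x')
    · exact h.real_le_mass y
  · calc |kernel μ r x y - kernel μ r x' y| ≤ max (kernel μ r x y) (kernel μ r x' y) :=
          abs_sub_le_of_nonneg_of_le (h.kernel_nonneg x y) (le_max_left _ _)
            (h.kernel_nonneg x' y) (le_max_right _ _)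
      _ ≤ 2 * D ^ 2 / (min (μ.real (ball x r)) (μ.real (ball x' r)) + μ.real (ball y r)) := by
          refine max_le ((h.kernel_le x y).trans ?_) ((h.kernel_le x' y).trans ?_)
          · gcongr; exact min_le_left _ _
          · gcongr; exact min_le_right _ _
      _ = 2 * D ^ 2 * r /
          (r * (min (μ.real (ball x r)) (μ.real (ball x' r)) + μ.real (ball y r))) := by
          field_simp
      _ ≤ _ := by
          gcongr <;> norm_num

lemma continuous_kernel : Continuous fun z : X × X => kernel μ r z.1 z.2 := by
  have hr := h.pos
  have hD := h.one_le
  have pos (x : X) : 0 < μ.real (ball x r) := h.real_pos hr (by linarith)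
  have bound (x x' y : X) : |kernel μ r x y - kernel μ r x' y| ≤
      8 * D ^ 8 * dist x x' / (r * μ.real (ball y r)) := by
    refine (h.abs_kernel_sub_le x x' y).trans ?_
    have := pos y
    gcongr
    exact le_add_of_nonneg_left (le_min (pos x).le (pos x').le)
  rw [continuous_iff_continuousAt]
  rintro ⟨x, y⟩
  rw [ContinuousAt, tendsto_iff_dist_tendsto_zero]
  have hV : 0 < μ.real (ball x (r / 2)) := h.real_pos (by linarith) (by linarith)
  refine squeeze_zero' (.of_forall fun _ => dist_nonneg)
    (Filter.eventually_of_mem (prod_mem_nhds (ball_mem_nhds x (half_pos hr)) Filter.univ_mem)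
      fun z hz => ?_)
    (g := fun z : X × X => 8 * D ^ 8 * dist z.1 x / (r * μ.real (ball y r))
      + 8 * D ^ 8 * dist z.2 y / (r * μ.real (ball x (r / 2)))) ?_
  · obtain ⟨x', y'⟩ := z
    have hx' : dist x' x < r / 2 := hz.1
    refine (dist_triangle _ (kernel μ r x' y) _).trans ?_
    rw [add_comm]
    refine add_le_add (bound x' x y) ?_
    rw [Real.dist_eq, kernel_comm μ r x' y', kernel_comm μ r x' y]
    refine (bound y' y x').trans ?_
    have hle : μ.real (ball x (r / 2)) ≤ μ.real (ball x' r) :=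
      h.real_mono (by rw [dist_comm]; linarith) (by linarith)
    gcongr
  · have : Continuous fun z : X × X => 8 * D ^ 8 * dist z.1 x / (r * μ.real (ball y r))
      + 8 * D ^ 8 * dist z.2 y / (r * μ.real (ball x (r / 2))) := by fun_prop
    simpa using this.tendsto (x, y)

lemma isSeparable_ball [μ.InnerRegular] (x : X) :
    TopologicalSpace.IsSeparable (ball x (4 * r)) := by
  choose K hKsub hK hKlt using fun n : ℕ =>
    (measurableSet_ball (x := x) (ε := 4 * r)).exists_isCompact_sdiff_lt (h.measure_ne_top x)
      (ε := ((n : ℝ≥0∞) + 1)⁻¹) (by simp)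
  refine TopologicalSpace.IsSeparable.mono (TopologicalSpace.IsSeparable.closure
    (.iUnion fun n => (hK n).isSeparable)) fun y hy => ?_
  rw [Metric.mem_closure_iff]
  by_contra! hcon
  obtain ⟨ε, hε, hdisj⟩ := hcon
  obtain ⟨δ, hδ, hsub⟩ := Metric.isOpen_ball.mem_nhds hy |> Metric.mem_nhds_iff.1
  have hpos := h.measure_pos y (min ε δ) (lt_min hε hδ)
  obtain ⟨n, hn⟩ := ENNReal.exists_inv_nat_lt hpos.ne'
  refine (hn.trans_le ?_).false
  have : ball y (min ε δ) ⊆ ball x (4 * r) \ K n := fun z hz => by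
    refine ⟨hsub (ball_subset_ball (min_le_right _ _) hz), fun hzK => ?_⟩
    have h1 := hdisj z (mem_iUnion.2 ⟨n, hzK⟩)
    have h2 := (mem_ball'.1 hz).trans_le (min_le_left _ _)
    linarith
  exact (measure_mono this).trans ((hKlt n).le.trans (ENNReal.inv_le_inv.2 le_self_add))

/-- Fubini's theorem for continuous bounded functions supported in the square of a ball. -/
lemma integral_integral_swap_of_support [μ.InnerRegular] {f : X → X → ℝ} {x : X} {M : ℝ}
    (hf : Continuous (Function.uncurry f)) (h1 : ∀ y z, y ∉ ball x (4 * r) → f y z = 0)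
    (h2 : ∀ y z, z ∉ ball x (4 * r) → f y z = 0)
    (hM : ∀ y ∈ ball x (4 * r), ∀ z, |f y z| ≤ M) :
    ∫ y, ∫ z, f y z ∂μ ∂μ = ∫ z, ∫ y, f y z ∂μ ∂μ := by
  set B := ball x (4 * r) with hB
  have hBm : MeasurableSet B := measurableSet_ball
  have : SecondCountableTopology B := (h.isSeparable_ball x).secondCountableTopology
  set ν : Measure B := μ.comap Subtype.val
  have : IsFiniteMeasure ν := ⟨by
    rw [comap_subtype_coe_apply hBm]
    simpa using (h.measure_ne_top x).lt_top⟩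
  have toSub {g : X → ℝ} (hg : ∀ y ∉ B, g y = 0) : ∫ y, g y ∂μ = ∫ y : B, g y ∂ν := by
    rw [integral_subtype_comap hBm, setIntegral_eq_integral_of_forall_compl_eq_zero hg]
  have hint : Integrable (Function.uncurry fun y z : B => f y z) (ν.prod ν) := by
    refine Integrable.of_bound (C := M) (Continuous.aestronglyMeasurable ?_)
      (.of_forall fun p => hM _ p.1.2 _)
    exact hf.comp (by fun_prop : Continuous fun p : B × B => ((p.1 : X), (p.2 : X)))
  calc ∫ y, ∫ z, f y z ∂μ ∂μ = ∫ y : B, ∫ z, f y z ∂μ ∂ν :=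
        toSub fun y hy => by simp [h1 y _ hy]
    _ = ∫ y : B, ∫ z : B, f y z ∂ν ∂ν := by congr! 2 with y; exact toSub fun z hz => h2 _ z hz
    _ = ∫ z : B, ∫ y : B, f y z ∂ν ∂ν := integral_integral_swap hint
    _ = ∫ z : B, ∫ y, f y z ∂μ ∂ν := by congr! 2 with z; exact (toSub fun y hy => h1 y _ hy).symm
    _ = _ := (toSub (g := fun z => ∫ y, f y z ∂μ) fun z hz => by simp [h2 _ z hz]).symm

lemma integral_kernel [μ.InnerRegular] (x : X) : ∫ y, kernel μ r x y ∂μ = 1 := by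
  have hr := h.pos
  have hV : 0 < μ.real (ball x r) := h.real_pos hr (by linarith)
  let f (y z : X) : ℝ := tent r x z * (weight μ r z * (tent r z y * (mass μ r y)⁻¹))
  have zero {y z : X} (hyz : 3 * r ≤ dist x y ∨ 3 * r / 2 ≤ dist x z) : f y z = 0 := by
    by_cases hz : 3 * r / 2 ≤ dist x z
    · simp [f, tent_eq_zero hr hz]
    · have : 3 * r / 2 ≤ dist z y := by
        rcases hyz with hy | hz'
        · linarith [dist_triangle x z y]
        · exact absurd hz' hz
      simp [f, tent_eq_zero hr this]
  have hcont : Continuous (Function.uncurry f) := by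
    have c1 := h.continuous_weight
    have c2 := h.continuous_inv_mass
    have c3 := continuous_tent_right r x
    have c4 := (continuous_tent (X := X) r).comp continuous_swap
    exact (c3.comp continuous_snd).mul ((c1.comp continuous_snd).mul
      (c4.mul (c2.comp continuous_fst)))
  have hbound (y z : X) : |f y z| ≤ D ^ 2 * (D ^ 2 / μ.real (ball x r)) := by
    by_cases hy : 3 * r ≤ dist x y
    · rw [zero (.inl hy), abs_zero]; positivity
    · have hw := h.weight_pos z
      have hm := inv_pos.2 (h.mass_pos y)
      have t1 := tent_nonneg r x z
      have t2 := tent_nonneg r z y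
      rw [abs_of_nonneg (by positivity)]
      calc tent r x z * (weight μ r z * (tent r z y * (mass μ r y)⁻¹))
          ≤ 1 * (D ^ 2 * (1 * (D ^ 2 / μ.real (ball x r)))) := by
            gcongr
            · exact tent_le_one _ _ _
            · exact h.weight_le z
            · exact tent_le_one _ _ _
            · exact h.inv_mass_le_of_mem (mem_ball'.2 (not_le.1 hy))
        _ = _ := by ring
  have swap := h.integral_integral_swap_of_support (x := x) hcont
    (fun y z hy => zero (.inl (by rw [mem_ball', not_lt] at hy; linarith)))
    (fun y z hz => zero (.inr (by rw [mem_ball', not_lt] at hz; linarith)))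
    (fun y _ z => hbound y z)
  have inner (z : X) : ∫ y, f y z ∂μ = tent r x z * 1 := by
    simp only [f]
    rw [integral_const_mul, integral_const_mul]
    congr 1
    exact inv_mul_cancel₀ (h.average_inv_mass_pos z).ne'
  have outer (y : X) : kernel μ r x y = (mass μ r x)⁻¹ * ∫ z, f y z ∂μ := by
    have : ∫ z, f y z ∂μ = preKernel μ r x y * (mass μ r y)⁻¹ := by
      unfold preKernel average
      rw [← integral_mul_const]
      congr! 2 with z
      simp only [f]; ring
    rw [this, kernel, div_eq_mul_inv, mul_inv]
    ring
  simp_rw [outer]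
  rw [integral_const_mul, swap]
  simp_rw [inner]
  exact inv_mul_cancel₀ (h.mass_pos x).ne'

end IsDoublingAt

/-- Doubling up to scale `ρ` forces balls of radius at most `2ρ` to have finite measure. -/
lemma measure_ball_ne_top (μ : Measure X) [IsLocallyFiniteMeasure μ] {ρ : ℝ} {D : ℝ≥0} (x : X)
    (hD : ∀ s ∈ Ioc 0 ρ, μ (ball x (2 * s)) ≤ (D : ℝ≥0∞) * μ (ball x s)) {s : ℝ}
    (hs0 : 0 < s) (hs : s ≤ 2 * ρ) : μ (ball x s) ≠ ∞ := by
  obtain ⟨U, hU, hUfin⟩ := μ.finiteAt_nhds x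
  obtain ⟨ε, hε, hsub⟩ := Metric.mem_nhds_iff.1 hU
  obtain ⟨n, hn⟩ := exists_pow_lt_of_lt_one (div_pos hε hs0) one_half_lt_one
  have halve (n : ℕ) : ∀ s, 0 < s → s ≤ 2 * ρ → s * (1 / 2) ^ n ≤ ε → μ (ball x s) ≠ ∞ := by
    induction n with
    | zero =>
      intro s _ _ hsε
      exact measure_ne_top_of_subset ((ball_subset_ball (by simpa using hsε)).trans hsub) hUfin.ne
    | succ n ih =>
      intro s hs0 hs hsε
      have h1 := ih (s / 2) (by linarith) (by linarith) (by rw [pow_succ] at hsε; linarith)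
      have h2 := hD (s / 2) ⟨by linarith, by linarith⟩
      rw [mul_div_cancel₀ s two_ne_zero] at h2
      exact (h2.trans_lt (ENNReal.mul_lt_top coe_lt_top h1.lt_top)).ne
  refine halve n s hs0 hs ?_
  rw [lt_div_iff₀ hs0] at hn
  linarith

end LocalSmoothing

/-- existence of local smoothing kernels on a locally doubling space.
`D` is a finite doubling constant for radii `≤ 4R`, and `V_r(x) = μ(B(x,r))`
(taken as a real number via `toReal`). -/
theorem stmt_15 {X : Type*} [MetricSpace X] [MeasurableSpace X] [BorelSpace X]
    [LocallyCompactSpace X] (μ : Measure X) [μ.InnerRegular] [IsFiniteMeasureOnCompacts μ]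
    (hsupp : ∀ (x : X) (r : ℝ), 0 < r → 0 < μ (ball x r))
    (R : ℝ) (hR : 0 < R) (D : ℝ≥0) (hD1 : 1 ≤ D)
    (hD : ∀ (x : X), ∀ r ∈ Set.Ioc (0 : ℝ) (4 * R),
      μ (ball x (2 * r)) ≤ (D : ℝ≥0∞) * μ (ball x r)) :
    ∃ (S : ℝ → X → X → ℝ) (C : ℝ), 1 < C ∧ ∀ r ∈ Set.Ioc (0 : ℝ) R,
      Continuous (fun z : X × X => S r z.1 z.2) ∧
      (∀ x y : X, 0 ≤ S r x y) ∧
      -- (1)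
      (∀ x y : X, 3 * r ≤ dist x y → S r x y = 0) ∧
      -- (2)
      (∀ x y : X, S r x y = S r y x) ∧
      -- (3)
      (∀ x : X, ∫ y, S r x y ∂μ = 1) ∧
      -- (4)
      (∀ x y : X, dist x y < r / 2 →
        1 / ((D : ℝ) ^ 5 * min (μ (ball x r)).toReal (μ (ball y r)).toReal) ≤ S r x y) ∧
      -- (5)
      (∀ x y : X, S r x y ≤ 2 * (D : ℝ) ^ 2 / ((μ (ball x r)).toReal + (μ (ball y r)).toReal)) ∧
      -- (6)
      (∀ x x' y : X, |S r x y - S r x' y| ≤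
        C * (D : ℝ) ^ 8 * dist x x' /
          (r * (min (μ (ball x r)).toReal (μ (ball x' r)).toReal + (μ (ball y r)).toReal))) := by
  have hdbl (r : ℝ) (hr : r ∈ Ioc 0 R) : LocalSmoothing.IsDoublingAt μ r D := by
    have fin (x : X) {s : ℝ} (h0 : 0 < s) (hs : s ≤ 2 * (4 * R)) : μ (ball x s) ≠ ∞ :=
      LocalSmoothing.measure_ball_ne_top μ x (hD x) h0 hs
    obtain ⟨h0, hrR⟩ := hr
    refine ⟨h0, mod_cast hD1, fun x => fin x (by linarith) (by linarith), hsupp, ?_⟩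
    rintro x s ⟨hs0, hs⟩
    have h1 := ENNReal.toReal_mono (ENNReal.mul_ne_top coe_ne_top (fin x hs0 (by linarith)))
      (hD x s ⟨hs0, by linarith⟩)
    rwa [ENNReal.toReal_mul] at h1
  refine ⟨LocalSmoothing.kernel μ, 8, by norm_num, fun r hr => ?_⟩
  have h := hdbl r hr
  exact ⟨h.continuous_kernel, h.kernel_nonneg, fun x y => h.kernel_eq_zero,
    LocalSmoothing.kernel_comm μ r, h.integral_kernel, fun x y => h.le_kernel, h.kernel_le,
    h.abs_kernel_sub_le⟩
end
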